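/- arXiv:0809.3768 — 9 statements merged into one kernel-verified Lean document; each statement's English description precedes it below -/
import Mathlib

section
/- Let A₁ and A₂ be Hurwitz real 2×2 matrices. If Γ(A₁,A₂) > −√(det(A₁)det(A₂)) and tr(A₁A₂) > −2√(det(A₁)det(A₂)), then there exists a common quadratic Lyapunov function for the pair (A₁,A₂), i.e. a symmetric positive definite real 2×2 matrix P such that both A₁ᵀP + PA₁ and A₂ᵀP + PA₂ are negative definite. -/
open Matrix

/-- A real 2×2 matrix is Hurwitz: both eigenvalues have negative real part,
equivalently trace < 0 and det > 0. -/
def Hurwitz (A : Matrix (Fin 2) (Fin 2) ℝ) : Prop := A.trace < 0 ∧ 0 < A.det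

/-- Γ(X,Y) := (1/2)(tr X · tr Y − tr (XY)). -/
noncomputable def Gam (X Y : Matrix (Fin 2) (Fin 2) ℝ) : ℝ :=
  (1 / 2) * (X.trace * Y.trace - (X * Y).trace)

/-- Existence of a suitable `P` for a single normalised matrix. -/
lemma single_aux (Δ l m n a : ℝ) (h : Δ = a^2 - m^2 + 4*l*n) :
    Δ * (((m-a)^2 + (2*n)^2 + Δ) * ((2*l)^2 + (a+m)^2 + Δ)
      - (-((m-a)*(2*l)) - (2*n)*(a+m))^2)
      - (l * ((m-a)^2 + (2*n)^2 + Δ) + m * (-((m-a)*(2*l)) - (2*n)*(a+m))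
        + n * ((2*l)^2 + (a+m)^2 + Δ))^2 = 4*a^2*Δ^2 := by
  subst h; ring

lemma single (l m n a : ℝ) (ha : 0 < a) (h : m^2 - 4*l*n = a^2 - 1) :
    ∃ p q r : ℝ, (l*p + m*q + n*r)^2 < p*r - q^2 := by
  have := single_aux 1 l m n a (by linarith)
  refine ⟨(m-a)^2 + (2*n)^2 + 1, -((m-a)*(2*l)) - (2*n)*(a+m), (2*l)^2 + (a+m)^2 + 1, ?_⟩
  have h2 : 0 < a^2 := by positivity
  linarith

/-- Parallel case. -/
lemma par (l m n l' m' n' a : ℝ) (ha : 0 < a) (h1 : m^2 - 4*l*n = a^2 - 1)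
    (e1 : m*n' - n*m' = 0) (e2 : n*l' - l*n' = 0) (e3 : l*m' - m*l' = 0)
    (hn : l'^2 + m'^2 + n'^2 ≤ l^2 + m^2 + n^2) :
    ∃ p q r : ℝ, (l*p + m*q + n*r)^2 < p*r - q^2 ∧ (l'*p + m'*q + n'*r)^2 < p*r - q^2 := by
  obtain ⟨p, q, r, h⟩ := single l m n a ha h1
  refine ⟨p, q, r, h, lt_of_le_of_lt ?_ h⟩
  rcases eq_or_lt_of_le (show 0 ≤ l^2 + m^2 + n^2 by positivity) with h0 | h0
  · have i1 : l' = 0 := by nlinarith [sq_nonneg l', sq_nonneg m', sq_nonneg n']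
    have i2 : m' = 0 := by nlinarith [sq_nonneg l', sq_nonneg m', sq_nonneg n']
    have i3 : n' = 0 := by nlinarith [sq_nonneg l', sq_nonneg m', sq_nonneg n']
    subst i1 i2 i3
    have := sq_nonneg (l*p + m*q + n*r)
    linarith
  · have f1 : l * (l'*p + m'*q + n'*r) = l' * (l*p + m*q + n*r) := by
      linear_combination q * e3 - r * e2
    have f2 : m * (l'*p + m'*q + n'*r) = m' * (l*p + m*q + n*r) := by
      linear_combination r * e1 - p * e3
    have f3 : n * (l'*p + m'*q + n'*r) = n' * (l*p + m*q + n*r) := by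
      linear_combination p * e2 - q * e1
    generalize l'*p + m'*q + n'*r = y at *
    generalize l*p + m*q + n*r = x at *
    have g : (l^2 + m^2 + n^2) * y^2 = (l'^2 + m'^2 + n'^2) * x^2 := by
      linear_combination (l*y + l'*x) * f1 + (m*y + m'*x) * f2 + (n*y+n'*x) * f3
    have := mul_le_mul_of_nonneg_right hn (sq_nonneg x)
    exact le_of_mul_le_mul_left (by linarith) h0

/-- The second vector is nearly parallel to a timelike first one. -/
lemma caseA (l m n l' m' n' a k : ℝ) (ha : 0 < a) (h1 : m^2 - 4*l*n = a^2 - 1)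
    (hk : m*m' - 2*l*n' - 2*l'*n = k) (hk0 : 0 ≤ k) (ha1 : a < 1) (hk1 : k ≤ 1 - a^2) :
    ∃ p q r : ℝ, (l*p + m*q + n*r)^2 < p*r - q^2 ∧ (l'*p + m'*q + n'*r)^2 < p*r - q^2 := by
  have e1 : l*(2*n) + m*(-m) + n*(2*l) = 1 - a^2 := by linarith
  have e2 : l'*(2*n) + m'*(-m) + n'*(2*l) = -k := by linarith
  have e3 : (2*n)*(2*l) - (-m)^2 = 1 - a^2 := by linarith
  have a2 : 0 < a^2 := by positivity
  have a3 : 0 < 1 - a^2 := by nlinarith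
  refine ⟨2*n, -m, 2*l, ?_, ?_⟩
  · rw [e1, e3]; nlinarith
  · rw [e2, e3]; nlinarith

lemma core_pos (l m n l' m' n' a b k : ℝ) (ha : 0 < a) (hb : 0 < b) (hab : a ≤ b)
    (h1 : m^2 - 4*l*n = a^2 - 1) (h2 : m'^2 - 4*l'*n' = b^2 - 1)
    (hk : m*m' - 2*l*n' - 2*l'*n = k) (hk0 : 0 ≤ k) (hk1 : k < 1 + a*b) :
    ∃ p q r : ℝ, (l*p + m*q + n*r)^2 < p*r - q^2 ∧ (l'*p + m'*q + n'*r)^2 < p*r - q^2 := by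
  by_cases hA : a < 1 ∧ k ≤ 1 - a^2
  · exact caseA l m n l' m' n' a k ha h1 hk hk0 hA.1 hA.2
  have hD : 4 * ((m*n' - n*m')*(l*m' - m*l') - (n*l' - l*n')^2) =
      (a^2-1)*(b^2-1) - k^2 := by
    rw [← h1, ← h2, ← hk]; ring
  rcases lt_trichotomy ((a^2-1)*(b^2-1) - k^2) 0 with D | D | D
  · have hk2 : 1 - k < a*b := by
      by_cases h : a < 1
      · have : 1 - a^2 < k := by
          by_contra hc
          exact hA ⟨h, not_lt.mp hc⟩
        nlinarith
      · have i1 : 1 ≤ a := not_lt.mp h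
        have i2 : 1 ≤ b := i1.trans hab
        have i3 : 0 ≤ (a^2-1)*(b^2-1) := mul_nonneg (by nlinarith) (by nlinarith)
        have i4 : 0 < k := by
          rcases hk0.eq_or_lt with h | h
          · rw [← h] at D; linarith
          · exact h
        nlinarith
    have hm : 0 < (a*b)^2 - (k-1)^2 := by
      have := mul_pos (show 0 < a*b - (k-1) by linarith) (show 0 < a*b + (k-1) by linarith)
      linarith
    have u : ∀ α β : ℝ, l*(α*(2*n)+β*(2*n')) + m*(α*(-m)+β*(-m')) + n*(α*(2*l)+β*(2*l'))
        = -(α*(a^2-1) + β*k) := by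
      intro α β; rw [← h1, ← hk]; ring
    have u' : ∀ α β : ℝ, l'*(α*(2*n)+β*(2*n')) + m'*(α*(-m)+β*(-m')) + n'*(α*(2*l)+β*(2*l'))
        = -(α*k + β*(b^2-1)) := by
      intro α β; rw [← h2, ← hk]; ring
    have u2 : ∀ α β : ℝ, (α*(2*n)+β*(2*n'))*(α*(2*l)+β*(2*l')) - (α*(-m)+β*(-m'))^2
        = -(α^2*(a^2-1) + 2*α*β*k + β^2*(b^2-1)) := by
      intro α β; rw [← h1, ← h2, ← hk]; ring
    have hp := mul_pos (neg_pos.mpr D) hm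
    refine ⟨(b^2-1+k)*(2*n) + (-(a^2-1+k))*(2*n'),
      (b^2-1+k)*(-m) + (-(a^2-1+k))*(-m'),
      (b^2-1+k)*(2*l) + (-(a^2-1+k))*(2*l'), ?_, ?_⟩
    · rw [u, u2]; linarith
    · rw [u', u2]; linarith
  · set p := m*n' - n*m' with hp
    set q := n*l' - l*n' with hq
    set r := l*m' - m*l' with hr
    have o1 : l*p + m*q + n*r = 0 := by rw [hp, hq, hr]; ring
    have o2 : l'*p + m'*q + n'*r = 0 := by rw [hp, hq, hr]; ring
    have d0 : p*r - q^2 = 0 := by linarith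
    by_cases hs : p + r = 0
    · have hr' : r = -p := by linarith
      rw [hr'] at d0
      have p0 : p = 0 := by nlinarith [sq_nonneg p, sq_nonneg q]
      have q0 : q = 0 := by nlinarith [sq_nonneg p, sq_nonneg q]
      have r0 : r = 0 := by linarith
      rcases le_total (l'^2 + m'^2 + n'^2) (l^2 + m^2 + n^2) with h | h
      · exact par l m n l' m' n' a ha h1 p0 q0 r0 h
      · obtain ⟨x, y, z, i, j⟩ := par l' m' n' l m n b hb h2 (by linarith) (by linarith)
          (by linarith) h
        exact ⟨x, y, z, j, i⟩
    · -- P = M (p+r) n + I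
      obtain ⟨M, hM1, hM2⟩ : ∃ M : ℝ, (l+n)^2 < M * (p+r)^2 ∧ (l'+n')^2 < M * (p+r)^2 := by
        have hpos : 0 < (p+r)^2 := by positivity
        refine ⟨((l+n)^2 + (l'+n')^2 + 1) / (p+r)^2, ?_, ?_⟩ <;>
        · rw [div_mul_cancel₀ _ hpos.ne']
          nlinarith [sq_nonneg (l+n), sq_nonneg (l'+n')]
      refine ⟨M*(p+r)*p + 1, M*(p+r)*q, M*(p+r)*r + 1, ?_, ?_⟩
      · have e1 : l*(M*(p+r)*p + 1) + m*(M*(p+r)*q) + n*(M*(p+r)*r + 1) = l + n := by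
          linear_combination M*(p+r)*o1
        rw [e1]
        have : (M*(p+r)*p + 1)*(M*(p+r)*r + 1) - (M*(p+r)*q)^2 = M*(p+r)^2 + 1 := by
          linear_combination (M*(p+r))^2*d0
        linarith
      · have e1 : l'*(M*(p+r)*p + 1) + m'*(M*(p+r)*q) + n'*(M*(p+r)*r + 1) = l' + n' := by
          linear_combination M*(p+r)*o2
        rw [e1]
        have : (M*(p+r)*p + 1)*(M*(p+r)*r + 1) - (M*(p+r)*q)^2 = M*(p+r)^2 + 1 := by
          linear_combination (M*(p+r))^2*d0
        linarith
  · refine ⟨m*n' - n*m', n*l' - l*n', l*m' - m*l', ?_, ?_⟩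
    · have : l*(m*n' - n*m') + m*(n*l' - l*n') + n*(l*m' - m*l') = 0 := by ring
      rw [this]; linarith
    · have : l'*(m*n' - n*m') + m'*(n*l' - l*n') + n'*(l*m' - m*l') = 0 := by ring
      rw [this]; linarith

lemma core_le (l m n l' m' n' a b : ℝ) (ha : 0 < a) (hb : 0 < b) (hab : a ≤ b)
    (h1 : m^2 - 4*l*n = a^2 - 1) (h2 : m'^2 - 4*l'*n' = b^2 - 1)
    (hk : |m*m' - 2*l*n' - 2*l'*n| < 1 + a*b) :
    ∃ p q r : ℝ, (l*p + m*q + n*r)^2 < p*r - q^2 ∧ (l'*p + m'*q + n'*r)^2 < p*r - q^2 := by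
  rw [abs_lt] at hk
  rcases le_total 0 (m*m' - 2*l*n' - 2*l'*n) with h | h
  · exact core_pos l m n l' m' n' a b _ ha hb hab h1 h2 rfl h hk.2
  · obtain ⟨p, q, r, i, j⟩ := core_pos l m n (-l') (-m') (-n') a b _ ha hb hab h1
      (by linarith) rfl (by linarith) (by linarith)
    refine ⟨p, q, r, i, ?_⟩
    have : (-l'*p + -m'*q + -n'*r)^2 = (l'*p + m'*q + n'*r)^2 := by ring
    linarith

lemma core (l m n l' m' n' a b : ℝ) (ha : 0 < a) (hb : 0 < b)
    (h1 : m^2 - 4*l*n = a^2 - 1) (h2 : m'^2 - 4*l'*n' = b^2 - 1)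
    (hk : |m*m' - 2*l*n' - 2*l'*n| < 1 + a*b) :
    ∃ p q r : ℝ, 0 < p ∧
      (l*p + m*q + n*r)^2 < p*r - q^2 ∧ (l'*p + m'*q + n'*r)^2 < p*r - q^2 := by
  have : ∃ p q r : ℝ,
      (l*p + m*q + n*r)^2 < p*r - q^2 ∧ (l'*p + m'*q + n'*r)^2 < p*r - q^2 := by
    rcases le_total a b with h | h
    · exact core_le l m n l' m' n' a b ha hb h h1 h2 hk
    · obtain ⟨p, q, r, i, j⟩ := core_le l' m' n' l m n b a hb ha h h2 h1 (by
        rw [show m'*m - 2*l'*n - 2*l*n' = m*m' - 2*l*n' - 2*l'*n by ring, mul_comm b a]; exact hk)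
      exact ⟨p, q, r, j, i⟩
  obtain ⟨p, q, r, i, j⟩ := this
  rcases lt_trichotomy p 0 with h | h | h
  · refine ⟨-p, -q, -r, by linarith, by linarith, by linarith⟩
  · subst h
    nlinarith [sq_nonneg q, sq_nonneg (l*0 + m*q + n*r)]
  · exact ⟨p, q, r, h, i, j⟩

lemma posDef_two (x y z : ℝ) (hx : 0 < x) (hd : 0 < x*z - y^2) :
    (!![x, y; y, z] : Matrix (Fin 2) (Fin 2) ℝ).PosDef := by
  refine Matrix.PosDef.of_dotProduct_mulVec_pos ?_ ?_
  · ext i j; fin_cases i <;> fin_cases j <;> simp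
  · intro v hv
    simp only [dotProduct, mulVec, Fin.sum_univ_two, Pi.star_apply, star_trivial]
    simp
    have key : x * (v 0 * (x * v 0 + y * v 1) + v 1 * (y * v 0 + z * v 1))
        = (x * v 0 + y * v 1)^2 + (x*z - y^2) * (v 1)^2 := by ring
    refine pos_of_mul_pos_right (a := x) ?_ hx.le
    rw [key]
    by_cases h1 : v 1 = 0
    · have h0 : v 0 ≠ 0 := by
        intro h0; apply hv; ext i; fin_cases i <;> simp [h0, h1]
      rw [h1]
      have : x * v 0 ≠ 0 := mul_ne_zero hx.ne' h0
      simp only [mul_zero, add_zero]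
      positivity
    · have := sq_nonneg (x * v 0 + y * v 1)
      have : 0 < (x*z - y^2) * (v 1)^2 := by positivity
      linarith

lemma lyap (a b c d p q r : ℝ) (ht : a + d < 0) (hp : 0 < p) (hP : 0 < p*r - q^2)
    (h : (b*p + (d-a)*q - c*r)^2 < 4 * (a*d - b*c) * (p*r - q^2)) :
    (-((!![a, b; c, d] : Matrix (Fin 2) (Fin 2) ℝ)ᵀ * !![p, q; q, r]
      + !![p, q; q, r] * !![a, b; c, d])).PosDef := by
  have e : -((!![a, b; c, d] : Matrix (Fin 2) (Fin 2) ℝ)ᵀ * !![p, q; q, r]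
      + !![p, q; q, r] * !![a, b; c, d])
      = !![-(2*(a*p + c*q)), -(b*p + (a+d)*q + c*r);
          -(b*p + (a+d)*q + c*r), -(2*(b*q + d*r))] := by
    ext i j; fin_cases i <;> fin_cases j <;>
      simp [Matrix.mul_apply, Fin.sum_univ_two] <;> ring
  rw [e]
  have hdet : 0 < -(2*(a*p + c*q)) * -(2*(b*q + d*r)) - (-(b*p + (a+d)*q + c*r))^2 := by
    linarith
  refine posDef_two _ _ _ ?_ hdet
  -- trace argument
  by_contra hc
  have hx : 0 ≤ a*p + c*q := by linarith
  set X := a*p + c*q with hX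
  set Z := b*q + d*r with hZ
  set Y := b*p + (a+d)*q + c*r with hY
  -- r X + p Z - q Y = (a + d)(p r - q^2)
  have tr : r*X*2 - 2*q*Y + p*Z*2 = 2*(a+d)*(p*r-q^2) := by rw [hX, hY, hZ]; ring
  have tn : 2*(a+d)*(p*r-q^2) < 0 := by nlinarith
  have hd' : Y^2 < 4*X*Z := by linarith
  have X0 : 0 < X := by
    rcases hx.eq_or_lt with h | h
    · rw [← h] at hd'; nlinarith [sq_nonneg Y]
    · exact h
  have id : 2*X*p*(r*X*2 - 2*q*Y + p*Z*2) = (2*X*q - p*Y)^2 + p^2*(4*X*Z - Y^2)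
      + 4*X^2*(p*r-q^2) := by ring
  have pos : 0 < 2*X*p*(r*X*2 - 2*q*Y + p*Z*2) := by
    rw [id]
    have := sq_nonneg (2*X*q - p*Y)
    have : 0 < p^2*(4*X*Z - Y^2) := mul_pos (by positivity) (by linarith)
    have : 0 < 4*X^2*(p*r-q^2) := by positivity
    linarith
  rw [tr] at pos
  have : 0 < 2*X*p := by positivity
  nlinarith

theorem stmt_0 (A₁ A₂ : Matrix (Fin 2) (Fin 2) ℝ)
    (h₁ : Hurwitz A₁) (h₂ : Hurwitz A₂)
    (hΓ : Gam A₁ A₂ > - Real.sqrt (A₁.det * A₂.det))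
    (htr : (A₁ * A₂).trace > -2 * Real.sqrt (A₁.det * A₂.det)) :
    ∃ P : Matrix (Fin 2) (Fin 2) ℝ, P.IsSymm ∧ P.PosDef ∧
      (-(A₁ᵀ * P + P * A₁)).PosDef ∧ (-(A₂ᵀ * P + P * A₂)).PosDef := by
  obtain ⟨t1, d1⟩ := h₁
  obtain ⟨t2, d2⟩ := h₂
  rw [Real.sqrt_mul d1.le] at hΓ htr
  unfold Gam at hΓ
  have s1 := Real.sqrt_pos.mpr d1
  have s2 := Real.sqrt_pos.mpr d2
  have q1 := Real.sq_sqrt d1.le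
  have q2 := Real.sq_sqrt d2.le
  generalize √A₁.det = s at *
  generalize √A₂.det = t at *
  rw [Matrix.eta_fin_two A₁, Matrix.eta_fin_two A₂] at *
  generalize A₁ 0 0 = a, A₁ 0 1 = b, A₁ 1 0 = c, A₁ 1 1 = d at *
  generalize A₂ 0 0 = a', A₂ 0 1 = b', A₂ 1 0 = c', A₂ 1 1 = d' at *
  simp [Matrix.trace_fin_two, Matrix.det_fin_two] at t1 t2 d1 d2 q1 q2 hΓ htr
  obtain ⟨p, q, r, hp, i, j⟩ := core (b/(2*s)) ((d-a)/(2*s)) (-c/(2*s))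
    (b'/(2*t)) ((d'-a')/(2*t)) (-c'/(2*t)) (-(a+d)/(2*s)) (-(a'+d')/(2*t))
    (div_pos (by linarith) (by linarith)) (div_pos (by linarith) (by linarith))
    (by field_simp; linarith) (by field_simp; linarith)
    (by
      have e : (d-a)/(2*s) * ((d'-a')/(2*t)) - 2*(b/(2*s))*(-c'/(2*t)) - 2*(b'/(2*t))*(-c/(2*s))
          = ((d-a)*(d'-a') + 2*b*c' + 2*b'*c) / (4*s*t) := by field_simp; ring
      have e' : 1 + -(a+d)/(2*s) * (-(a'+d')/(2*t))
          = (4*s*t + (a+d)*(a'+d')) / (4*s*t) := by field_simp; ring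
      have st : 0 < 4*s*t := by positivity
      rw [e, e', abs_div, abs_of_pos st, div_lt_div_iff_of_pos_right st, abs_lt]
      constructor <;> linarith)
  have hP : 0 < p*r - q^2 := lt_of_le_of_lt (sq_nonneg _) i
  refine ⟨!![p, q; q, r], ?_, posDef_two p q r hp hP, ?_, ?_⟩
  · ext i j; fin_cases i <;> fin_cases j <;> simp
  · refine lyap a b c d p q r t1 hp hP ?_
    rw [← q1]
    have e : b/(2*s)*p + (d-a)/(2*s)*q + -c/(2*s)*r = (b*p + (d-a)*q - c*r)/(2*s) := by
      field_simp; ring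
    rw [e, div_pow, div_lt_iff₀ (by positivity)] at i
    linarith
  · refine lyap a' b' c' d' p q r t2 hp hP ?_
    rw [← q2]
    have e : b'/(2*t)*p + (d'-a')/(2*t)*q + -c'/(2*t)*r = (b'*p + (d'-a')*q - c'*r)/(2*t) := by
      field_simp; ring
    rw [e, div_pow, div_lt_iff₀ (by positivity)] at j
    linarith
end

section
/- Let A₁ and A₂ be Hurwitz real 2×2 matrices. If Γ(A₁,A₂) < −√(det(A₁)det(A₂)), then the switched system ẋ = u(t)A₁x + (1−u(t))A₂x is unbounded. -/
open Matrix

/-- A switching control: a measurable function with values in {0,1}. -/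
def IsControl (u : ℝ → ℝ) : Prop := Measurable u ∧ ∀ t, u t = 0 ∨ u t = 1

/-- A trajectory of the switched system ẋ = u(t)A₁x + (1−u(t))A₂x with control `u`:
a locally absolutely continuous curve solving the ODE almost everywhere, expressed in
integral form. -/
def IsTrajectory (A₁ A₂ : Matrix (Fin 2) (Fin 2) ℝ) (u : ℝ → ℝ) (γ : ℝ → Fin 2 → ℝ) : Prop :=
  Continuous γ ∧ ∀ t : ℝ, 0 ≤ t →
    γ t = γ 0 + ∫ s in (0:ℝ)..t, (u s • A₁.mulVec (γ s) + (1 - u s) • A₂.mulVec (γ s))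

/-- Uniform stability of the switched system. -/
def UniformlyStable (A₁ A₂ : Matrix (Fin 2) (Fin 2) ℝ) : Prop :=
  ∀ ε > 0, ∃ δ > 0, ∀ u γ, IsControl u → IsTrajectory A₁ A₂ u γ →
    ‖γ 0‖ ≤ δ → ∀ t ≥ (0:ℝ), ‖γ t‖ ≤ ε

/-- Global uniform asymptotic stability (GUAS) of the switched system. -/
def GUAS (A₁ A₂ : Matrix (Fin 2) (Fin 2) ℝ) : Prop :=
  UniformlyStable A₁ A₂ ∧
  ∀ δ₁ > 0, ∀ δ₂ > 0, ∃ T > 0, ∀ u γ, IsControl u → IsTrajectory A₁ A₂ u γ →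
    ‖γ 0‖ ≤ δ₂ → ∀ t ≥ T, ‖γ t‖ ≤ δ₁

/-- The switched system is unbounded: some trajectory has norm tending to +∞. -/
def Unbounded (A₁ A₂ : Matrix (Fin 2) (Fin 2) ℝ) : Prop :=
  ∃ u γ, IsControl u ∧ IsTrajectory A₁ A₂ u γ ∧
    Filter.Tendsto (fun t => ‖γ t‖) Filter.atTop Filter.atTop

open scoped Matrix.Norms.Operator
open Filter Topology

/-- the flow over one period -/
noncomputable def phiAux (A₁ A₂ : Matrix (Fin 2) (Fin 2) ℝ) (a : ℝ) (v : Fin 2 → ℝ) (s : ℝ) :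
    Fin 2 → ℝ :=
  NormedSpace.exp ((max (s - a) 0) • A₂) *ᵥ (NormedSpace.exp ((min s a) • A₁) *ᵥ v)

lemma exp_mulVec_deriv (A : Matrix (Fin 2) (Fin 2) ℝ) (v : Fin 2 → ℝ) (t : ℝ) :
    HasDerivAt (fun s : ℝ => NormedSpace.exp (s • A) *ᵥ v)
      (A *ᵥ (NormedSpace.exp (t • A) *ᵥ v)) t := by
  have h := hasDerivAt_exp_smul_const' (𝕂 := ℝ) A t
  let L : Matrix (Fin 2) (Fin 2) ℝ →ₗ[ℝ] (Fin 2 → ℝ) :=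
    { toFun := fun M => M *ᵥ v
      map_add' := fun M N => Matrix.add_mulVec M N v
      map_smul' := fun c M => Matrix.smul_mulVec c M v }
  have h2 := (LinearMap.toContinuousLinearMap L).hasFDerivAt.comp_hasDerivAt t h
  have h3 : A *ᵥ (NormedSpace.exp (t • A) *ᵥ v) = (A * NormedSpace.exp (t • A)) *ᵥ v := by
    rw [Matrix.mulVec_mulVec]
  rw [h3]
  exact h2

lemma exp_mulVec_ne (A : Matrix (Fin 2) (Fin 2) ℝ) (v : Fin 2 → ℝ) (hv : v ≠ 0) :
    NormedSpace.exp A *ᵥ v ≠ 0 := by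
  intro h
  apply hv
  have h1 : NormedSpace.exp (-A) *ᵥ (NormedSpace.exp A *ᵥ v) = 0 := by rw [h, Matrix.mulVec_zero]
  rw [Matrix.mulVec_mulVec, ← Matrix.exp_add_of_commute _ _ ((Commute.refl A).neg_left)] at h1
  simpa using h1

lemma phiAux_cont (A₁ A₂ : Matrix (Fin 2) (Fin 2) ℝ) (a : ℝ) (v : Fin 2 → ℝ) :
    Continuous (phiAux A₁ A₂ a v) := by
  unfold phiAux
  apply Continuous.matrix_mulVec
  · exact NormedSpace.exp_continuous.comp (by fun_prop)
  · apply Continuous.matrix_mulVec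
    · exact NormedSpace.exp_continuous.comp (by fun_prop)
    · fun_prop

lemma phiAux_ne (A₁ A₂ : Matrix (Fin 2) (Fin 2) ℝ) (a : ℝ) (v : Fin 2 → ℝ) (hv : v ≠ 0) (s : ℝ) :
    phiAux A₁ A₂ a v s ≠ 0 :=
  exp_mulVec_ne _ _ (exp_mulVec_ne _ _ hv)

lemma phiAux_deriv1 (A₁ A₂ : Matrix (Fin 2) (Fin 2) ℝ) (a : ℝ) (v : Fin 2 → ℝ) (s : ℝ)
    (hs : s < a) : HasDerivAt (phiAux A₁ A₂ a v) (A₁ *ᵥ phiAux A₁ A₂ a v s) s := by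
  have key : ∀ x < a, phiAux A₁ A₂ a v x = NormedSpace.exp (x • A₁) *ᵥ v := by
    intro x hx
    unfold phiAux
    rw [max_eq_right (by linarith), min_eq_left hx.le]
    simp
  rw [key s hs]
  refine (exp_mulVec_deriv A₁ v s).congr_of_eventuallyEq ?_
  filter_upwards [Iio_mem_nhds hs] with x hx using key x hx

lemma phiAux_deriv2 (A₁ A₂ : Matrix (Fin 2) (Fin 2) ℝ) (a : ℝ) (v : Fin 2 → ℝ) (s : ℝ)
    (hs : a < s) : HasDerivAt (phiAux A₁ A₂ a v) (A₂ *ᵥ phiAux A₁ A₂ a v s) s := by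
  have key : ∀ x, a < x → phiAux A₁ A₂ a v x =
      NormedSpace.exp ((x - a) • A₂) *ᵥ (NormedSpace.exp (a • A₁) *ᵥ v) := by
    intro x hx
    unfold phiAux
    rw [max_eq_left (by linarith), min_eq_right hx.le]
  rw [key s hs]
  refine HasDerivAt.congr_of_eventuallyEq ?_
    (by filter_upwards [Ioi_mem_nhds hs] with x hx using key x hx)
  exact (exp_mulVec_deriv A₂ (NormedSpace.exp (a • A₁) *ᵥ v) (s - a)).comp_sub_const s a

lemma exists_period (A₁ A₂ : Matrix (Fin 2) (Fin 2) ℝ)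
    (h₁ : Hurwitz A₁) (h₂ : Hurwitz A₂)
    (hΓ : Gam A₁ A₂ < - Real.sqrt (A₁.det * A₂.det)) :
    ∃ a b ρ : ℝ, ∃ v : Fin 2 → ℝ, 0 < a ∧ 0 < b ∧ 1 < ρ ∧ v ≠ 0 ∧
      NormedSpace.exp (b • A₂) *ᵥ (NormedSpace.exp (a • A₁) *ᵥ v) = ρ • v := by
  obtain ⟨-, hd1⟩ := h₁
  obtain ⟨-, hd2⟩ := h₂
  set p := Real.sqrt A₂.det with hp
  set q := Real.sqrt A₁.det with hq
  have hp0 : 0 < p := Real.sqrt_pos.2 hd2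
  have hq0 : 0 < q := Real.sqrt_pos.2 hd1
  have hp2 : p ^ 2 = A₂.det := Real.sq_sqrt hd2.le
  have hq2 : q ^ 2 = A₁.det := Real.sq_sqrt hd1.le
  rw [Real.sqrt_mul hd1.le] at hΓ
  have hB : (p • A₁ + q • A₂).det < 0 := by
    have e : (p • A₁ + q • A₂).det = p^2 * A₁.det + q^2 * A₂.det + 2 * (p * q) * Gam A₁ A₂ := by
      simp [Gam, Matrix.det_fin_two, Matrix.trace_fin_two, Matrix.mul_apply, Fin.sum_univ_two]
      ring
    rw [e, ← hp2, ← hq2]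
    have : 0 < p * q := by positivity
    nlinarith
  let M : ℝ → Matrix (Fin 2) (Fin 2) ℝ := fun t =>
    NormedSpace.exp (t • (q • A₂)) * NormedSpace.exp (t • (p • A₁))
  have hM : HasDerivAt M (p • A₁ + q • A₂) 0 := by
    have h := (hasDerivAt_exp_smul_const (𝕂 := ℝ) (q • A₂) (0:ℝ)).mul
      (hasDerivAt_exp_smul_const (𝕂 := ℝ) (p • A₁) (0:ℝ))
    simp only [zero_smul, NormedSpace.exp_zero, one_mul, mul_one] at h
    rw [add_comm]
    exact h
  have hM0 : M 0 = 1 := by simp [M]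
  have ht := hM.tendsto_slope_zero_right
  have ht2 : Tendsto (fun t : ℝ => (t⁻¹ • (M (0 + t) - M 0)).det) (𝓝[>] 0)
      (𝓝 (p • A₁ + q • A₂).det) :=
    ((continuous_id.matrix_det).tendsto _).comp ht
  have hev := (ht2.eventually_lt_const hB).and self_mem_nhdsWithin
  obtain ⟨t, ht, htpos⟩ := hev.exists
  have htpos : 0 < t := htpos
  rw [zero_add, hM0, Matrix.det_smul] at ht
  have hneg : (M t - 1).det < 0 := by
    by_contra hcon
    push Not at hcon
    have : 0 ≤ t⁻¹ ^ Fintype.card (Fin 2) * (M t - 1).det := by positivity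
    linarith
  generalize hN : M t = N at hneg
  obtain ⟨ρ, hρ, hdet⟩ : ∃ ρ : ℝ, 1 < ρ ∧ (N - ρ • (1 : Matrix (Fin 2) (Fin 2) ℝ)).det = 0 := by
    have hn : (1:ℝ) - N.trace + N.det < 0 := by
      have : (N - 1).det = 1 - N.trace + N.det := by
        simp [Matrix.det_fin_two, Matrix.trace_fin_two]; ring
      linarith
    have hD : 0 ≤ N.trace ^ 2 - 4 * N.det := by nlinarith [sq_nonneg (N.trace - 2)]
    set D := Real.sqrt (N.trace ^ 2 - 4 * N.det) with hDdef
    have hD2 : D ^ 2 = N.trace ^ 2 - 4 * N.det := Real.sq_sqrt hD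
    have hD0 : 0 ≤ D := Real.sqrt_nonneg _
    refine ⟨(N.trace + D) / 2, ?_, ?_⟩
    · by_contra hc
      have : D ≤ 2 - N.trace := by linarith
      nlinarith
    · have e : ∀ ρ : ℝ, (N - ρ • (1 : Matrix (Fin 2) (Fin 2) ℝ)).det
          = ρ ^ 2 - N.trace * ρ + N.det := by
        intro ρ
        simp [Matrix.det_fin_two, Matrix.trace_fin_two]; ring
      rw [e]
      nlinarith
  obtain ⟨v, hv, hv0⟩ := Matrix.exists_mulVec_eq_zero_iff.2 hdet
  refine ⟨t * p, t * q, ρ, v, by positivity, by positivity, hρ, hv, ?_⟩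
  rw [Matrix.mulVec_mulVec, mul_smul, mul_smul]
  change M t *ᵥ v = _
  rw [hN]
  rw [Matrix.sub_mulVec, Matrix.smul_mulVec, Matrix.one_mulVec] at hv0
  exact sub_eq_zero.1 hv0

theorem stmt_2 (A₁ A₂ : Matrix (Fin 2) (Fin 2) ℝ)
    (h₁ : Hurwitz A₁) (h₂ : Hurwitz A₂)
    (hΓ : Gam A₁ A₂ < - Real.sqrt (A₁.det * A₂.det)) :
    Unbounded A₁ A₂ := by
  obtain ⟨a, b, ρ, v, ha, hb, hρ, hv, hper⟩ := exists_period A₁ A₂ h₁ h₂ hΓ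
  set T := a + b with hT
  have hT0 : 0 < T := by positivity
  set κ := Real.log ρ with hκ
  have hκ0 : 0 < κ := Real.log_pos hρ
  let φ := phiAux A₁ A₂ a v
  have hφc : Continuous φ := phiAux_cont A₁ A₂ a v
  have hφ0 : φ 0 = v := by
    simp [φ, phiAux, ha.le]
  have hφT : φ T = ρ • v := by
    simp only [φ, phiAux]
    rw [max_eq_left (by linarith), min_eq_right (by linarith), ← hper, hT, add_sub_cancel_left]
  let g : ℝ → Fin 2 → ℝ := fun x => Real.exp (-(κ * x)) • φ (T * x)
  have hgc : Continuous g := by fun_prop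
  have hg01 : g 0 = g 1 := by
    simp only [g, mul_zero, neg_zero, Real.exp_zero, one_smul, mul_one, hφ0, hφT]
    rw [Real.exp_neg, hκ, Real.exp_log (by linarith), smul_smul, inv_mul_cancel₀ (by linarith),
      one_smul]
  let γ : ℝ → Fin 2 → ℝ := fun t => Real.exp (κ * (t / T)) • g (Int.fract (t / T))
  have hγc : Continuous γ := by
    have hf : Continuous (fun x : ℝ => g (Int.fract x)) :=
      ContinuousOn.comp_fract'' hgc.continuousOn hg01
    have : Continuous (fun t : ℝ => g (Int.fract (t / T))) := hf.comp (continuous_id.div_const T)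
    have he : Continuous (fun t : ℝ => Real.exp (κ * (t / T))) := by fun_prop
    exact he.smul this
  have hγ : ∀ t, γ t = Real.exp (κ * ⌊t / T⌋) • φ (t - T * ⌊t / T⌋) := by
    intro t
    simp only [γ, g]
    rw [smul_smul, ← Real.exp_add]
    congr 2
    · rw [← Int.self_sub_floor]; ring
    · rw [← Int.self_sub_floor]; field_simp
  let u : ℝ → ℝ := fun t => if T * Int.fract (t / T) < a then 1 else 0
  have hum : Measurable u := by
    refine Measurable.ite ?_ measurable_const measurable_const
    exact measurableSet_lt (by fun_prop) measurable_const
  have hu01 : ∀ t, u t = 0 ∨ u t = 1 := by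
    intro t
    simp only [u]
    split_ifs <;> simp
  have hmv : ∀ A : Matrix (Fin 2) (Fin 2) ℝ, Continuous (fun s => A *ᵥ γ s) := fun A =>
    Continuous.matrix_mulVec continuous_const hγc
  refine ⟨u, γ, ⟨hum, hu01⟩, ⟨hγc, ?_⟩, ?_⟩
  · intro t ht
    let S : Set ℝ := Set.range (fun n : ℤ => T * (n:ℝ)) ∪ Set.range (fun n : ℤ => T * (n:ℝ) + a)
    have hS : S.Countable := (Set.countable_range _).union (Set.countable_range _)
    have hd : ∀ s, s ∉ S →
        HasDerivAt γ (u s • A₁.mulVec (γ s) + (1 - u s) • A₂.mulVec (γ s)) s := by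
      intro s hs
      set n := ⌊s / T⌋ with hn
      have hle : (n:ℝ) ≤ s / T := Int.floor_le _
      have hlt : s / T < n + 1 := Int.lt_floor_add_one _
      have hne1 : s ≠ T * n := fun h => hs (Or.inl ⟨n, h.symm⟩)
      have hne2 : s ≠ T * n + a := fun h => hs (Or.inr ⟨n, h.symm⟩)
      have hlt1 : (n:ℝ) < s / T := by
        refine lt_of_le_of_ne hle fun h => hne1 ?_
        rw [h]; field_simp
      have hev : γ =ᶠ[𝓝 s] fun x => Real.exp (κ * n) • φ (x - T * n) := by
        have : ∀ᶠ x in 𝓝 s, x / T ∈ Set.Ioo (n:ℝ) (n+1) :=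
          (continuous_id.div_const T).continuousAt.eventually (Ioo_mem_nhds hlt1 hlt)
        filter_upwards [this] with x hx
        have : ⌊x / T⌋ = n := Int.floor_eq_iff.2 ⟨hx.1.le, hx.2⟩
        rw [hγ, this]
      refine HasDerivAt.congr_of_eventuallyEq ?_ hev
      have hfr : T * Int.fract (s / T) = s - T * n := by
        rw [← Int.self_sub_floor]; field_simp; rfl
      rw [hγ s, ← hn]
      simp only [u, hfr, Matrix.mulVec_smul]
      split_ifs with hc
      · simp only [one_smul, sub_self, zero_smul, add_zero]
        exact ((phiAux_deriv1 A₁ A₂ a v _ hc).comp_sub_const s (T * n)).const_smul (Real.exp (κ * n))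
      · have hc' : a < s - T * n := by
          refine lt_of_le_of_ne (not_lt.1 hc) fun h => hne2 (by linarith)
        simp only [one_smul, sub_zero, zero_smul, zero_add]
        exact ((phiAux_deriv2 A₁ A₂ a v _ hc').comp_sub_const s (T * n)).const_smul (Real.exp (κ * n))
    have hint : IntervalIntegrable
        (fun s => u s • A₁.mulVec (γ s) + (1 - u s) • A₂.mulVec (γ s)) MeasureTheory.volume 0 t := by
      have hbd : IntervalIntegrable (fun s => ‖A₁ *ᵥ γ s‖ + ‖A₂ *ᵥ γ s‖)
          MeasureTheory.volume 0 t :=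
        Continuous.intervalIntegrable ((hmv A₁).norm.add (hmv A₂).norm) _ _
      refine hbd.mono_fun' ?_ ?_
      · refine Measurable.aestronglyMeasurable ?_
        exact (hum.smul (hmv A₁).measurable).add ((measurable_const.sub hum).smul (hmv A₂).measurable)
      · refine Filter.Eventually.of_forall fun s => ?_
        rcases hu01 s with h | h <;> simp [h]
    have := MeasureTheory.integral_eq_of_hasDerivAt_off_countable γ _ hS hγc.continuousOn
      (fun s hs => hd s hs.2) hint
    rw [this]; abel
  · obtain ⟨x₀, -, hx₀⟩ := isCompact_Icc.exists_isMinOn (Set.nonempty_Icc.2 (zero_le_one' ℝ))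
      hgc.norm.continuousOn
    have hpos : 0 < ‖g x₀‖ := by
      rw [norm_pos_iff]
      exact smul_ne_zero (Real.exp_pos _).ne' (phiAux_ne A₁ A₂ a v hv _)
    have hlow : ∀ t, Real.exp (κ * (t / T)) * ‖g x₀‖ ≤ ‖γ t‖ := by
      intro t
      simp only [γ, norm_smul, Real.norm_eq_abs, Real.abs_exp]
      gcongr
      exact hx₀ ⟨Int.fract_nonneg _, (Int.fract_lt_one _).le⟩
    refine tendsto_atTop_mono hlow ?_
    refine Tendsto.atTop_mul_const hpos (Real.tendsto_exp_atTop.comp ?_)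
    exact (tendsto_id.atTop_div_const hT0).const_mul_atTop hκ0
end

section
/- Let A₁ and A₂ be Hurwitz real 2×2 matrices. If Γ(A₁,A₂) < −√(det(A₁)det(A₂)), then there exists σ ∈ (0,1) such that det(σA₁ + (1−σ)A₂) < 0; consequently the matrix σA₁ + (1−σ)A₂ has a real eigenvalue that is strictly positive. -/
open Matrix

theorem exists_pos_eig (M : Matrix (Fin 2) (Fin 2) ℝ) (h : M.det < 0) :
    ∃ lam : ℝ, 0 < lam ∧ ∃ v : Fin 2 → ℝ, v ≠ 0 ∧ M.mulVec v = lam • v := by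
  have hs : 0 ≤ M.trace ^ 2 - 4 * M.det := by nlinarith [sq_nonneg M.trace]
  have hsq := Real.sq_sqrt hs
  have hs0 := Real.sqrt_nonneg (M.trace ^ 2 - 4 * M.det)
  set s := Real.sqrt (M.trace ^ 2 - 4 * M.det) with hsdef
  have hpos : 0 < (M.trace + s) / 2 := by
    have := abs_lt_of_sq_lt_sq (show M.trace ^ 2 < s ^ 2 by linarith) hs0
    linarith [neg_abs_le M.trace]
  refine ⟨(M.trace + s) / 2, hpos, ?_⟩
  have hdet : (M - ((M.trace + s) / 2) • (1 : Matrix (Fin 2) (Fin 2) ℝ)).det = 0 := by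
    clear_value s
    simp only [Matrix.det_fin_two, Matrix.trace_fin_two] at hsq ⊢
    simp
    linarith
  obtain ⟨v, hv, hv'⟩ := Matrix.exists_mulVec_eq_zero_iff.mpr hdet
  refine ⟨v, hv, ?_⟩
  rw [Matrix.sub_mulVec, Matrix.smul_mulVec, Matrix.one_mulVec] at hv'
  exact sub_eq_zero.mp hv'

theorem det_comb (A B : Matrix (Fin 2) (Fin 2) ℝ) (x y : ℝ) :
    (x • A + y • B).det = x ^ 2 * A.det + 2 * x * y * Gam A B + y ^ 2 * B.det := by
  simp [Gam, Matrix.det_fin_two, Matrix.trace_fin_two, Matrix.mul_apply, Fin.sum_univ_two]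
  ring

theorem stmt_3 (A₁ A₂ : Matrix (Fin 2) (Fin 2) ℝ)
    (h₁ : Hurwitz A₁) (h₂ : Hurwitz A₂)
    (hΓ : Gam A₁ A₂ < - Real.sqrt (A₁.det * A₂.det)) :
    ∃ σ ∈ Set.Ioo (0:ℝ) 1, (σ • A₁ + (1 - σ) • A₂).det < 0 ∧
      ∃ lam : ℝ, 0 < lam ∧ ∃ v : Fin 2 → ℝ, v ≠ 0 ∧
        (σ • A₁ + (1 - σ) • A₂).mulVec v = lam • v := by
  obtain ⟨-, hd₁⟩ := h₁
  obtain ⟨-, hd₂⟩ := h₂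
  rw [Real.sqrt_mul hd₁.le] at hΓ
  have hp := Real.sqrt_pos.mpr hd₁
  have hq := Real.sqrt_pos.mpr hd₂
  have hp2 := Real.sq_sqrt hd₁.le
  have hq2 := Real.sq_sqrt hd₂.le
  set p := Real.sqrt A₁.det
  set q := Real.sqrt A₂.det
  have hσ : 1 - q / (p + q) = p / (p + q) := by field_simp; ring
  have hdet : ((q / (p + q)) • A₁ + (1 - q / (p + q)) • A₂).det < 0 := by
    rw [det_comb, hσ, ← hp2, ← hq2]
    have e : (q / (p + q)) ^ 2 * p ^ 2 + 2 * (q / (p + q)) * (p / (p + q)) * Gam A₁ A₂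
        + (p / (p + q)) ^ 2 * q ^ 2 = 2 * p * q / (p + q) ^ 2 * (p * q + Gam A₁ A₂) := by
      field_simp
      ring
    rw [e]
    exact mul_neg_of_pos_of_neg (by positivity) (by linarith)
  refine ⟨q / (p + q), ⟨by positivity, ?_⟩, hdet, exists_pos_eig _ hdet⟩
  rw [div_lt_one (by positivity)]
  linarith
end

section
/- Let A₁ and A₂ be Hurwitz real 2×2 matrices. If Γ(A₁,A₂) = −√(det(A₁)det(A₂)), then the switched system ẋ = u(t)A₁x + (1−u(t))A₂x is uniformly stable but not GUAS. -/
open Matrix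

lemma alg_row (l0 l1 a b c e p q r w d : ℝ) (hd : d = a*e - b*c) (hd0 : 0 < d)
    (hs : a + e + p + w < 0) (hA : a + e < 0) (hB : p + w < 0)
    (hl : l0 ≠ 0 ∨ l1 ≠ 0)
    (h1 : l1*(r+c) = l0*(w+e)) (h2 : l0*(q+b) = l1*(p+a))
    (h3 : (l0*e - l1*c)*p + (-l0*b+l1*a)*r = -d*l0)
    (h4 : (l0*e - l1*c)*q + (-l0*b+l1*a)*w = -d*l1) :
    ∃ y0 y1 z0 z1 : ℝ, y0*z1 - y1*z0 ≠ 0 ∧ ∀ x0 x1 : ℝ,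
      d*(y0*x0+y1*x1)*(y0*(a*x0+b*x1)+y1*(c*x0+e*x1))
        + (z0*x0+z1*x1)*(z0*(a*x0+b*x1)+z1*(c*x0+e*x1)) ≤ 0 ∧
      d*(y0*x0+y1*x1)*(y0*(p*x0+q*x1)+y1*(r*x0+w*x1))
        + (z0*x0+z1*x1)*(z0*(p*x0+q*x1)+z1*(r*x0+w*x1)) ≤ 0 := by
  refine ⟨l0, l1, l0*e - l1*c, -l0*b+l1*a, ?_, ?_⟩
  · intro hΔ
    -- z is a multiple of l
    obtain ⟨m, hm0, hm1⟩ : ∃ m, l0*e - l1*c = m*l0 ∧ -l0*b+l1*a = m*l1 := by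
      rcases hl with h | h
      · exact ⟨(l0*e - l1*c)/l0, by field_simp, by field_simp; linear_combination hΔ⟩
      · exact ⟨(-l0*b+l1*a)/l1, by field_simp; linear_combination -hΔ, by field_simp⟩
    have k0 : m*(l0*a+l1*c) = d*l0 := by
      rw [hd]; linear_combination (-a)*hm0 - c*hm1
    have k1 : m*(l0*b+l1*e) = d*l1 := by
      rw [hd]; linear_combination (-b)*hm0 - e*hm1
    have k2 : m*(l0*p+l1*r) = -d*l0 := by
      linear_combination h3 - p*hm0 - r*hm1
    have k3 : m*(l0*q+l1*w) = -d*l1 := by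
      linear_combination h4 - q*hm0 - w*hm1
    have e0 : m*(a+e+p+w)*l0 = 0 := by
      linear_combination k0 + k2 - m*h1
    have e1 : m*(a+e+p+w)*l1 = 0 := by
      linear_combination k1 + k3 - m*h2
    have hm : m = 0 := by
      rcases hl with h | h
      · simpa [h, hs.ne] using e0
      · simpa [h, hs.ne] using e1
    subst hm
    rcases hl with h | h
    · have : d*l0 = 0 := by linarith
      simp [h, hd0.ne'] at this
    · have : d*l1 = 0 := by linarith
      simp [h, hd0.ne'] at this
  · intro x0 x1
    constructor
    · have : d*(l0*x0+l1*x1)*(l0*(a*x0+b*x1)+l1*(c*x0+e*x1))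
        + ((l0*e - l1*c)*x0+(-l0*b+l1*a)*x1)*((l0*e - l1*c)*(a*x0+b*x1)+(-l0*b+l1*a)*(c*x0+e*x1))
        = d*(a+e)*(l0*x0+l1*x1)^2 := by
        rw [hd]; ring
      rw [this]
      have := mul_nonneg (mul_nonneg hd0.le (neg_nonneg.2 hA.le)) (sq_nonneg (l0*x0+l1*x1))
      linarith
    · have : d*(l0*x0+l1*x1)*(l0*(p*x0+q*x1)+l1*(r*x0+w*x1))
        + ((l0*e - l1*c)*x0+(-l0*b+l1*a)*x1)*((l0*e - l1*c)*(p*x0+q*x1)+(-l0*b+l1*a)*(r*x0+w*x1))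
        = d*(p+w)*(l0*x0+l1*x1)^2 := by
        linear_combination (((l0*e - l1*c)*x0+(-l0*b+l1*a)*x1)*x0)*h3
          + (((l0*e - l1*c)*x0+(-l0*b+l1*a)*x1)*x1)*h4
          + (d*(l0*x0+l1*x1)*x0)*h1 + (d*(l0*x0+l1*x1)*x1)*h2
      rw [this]
      have := mul_nonneg (mul_nonneg hd0.le (neg_nonneg.2 hB.le)) (sq_nonneg (l0*x0+l1*x1))
      linarith

lemma alg_main (a b c e p q r w d : ℝ) (hd : d = a*e - b*c) (hd0 : 0 < d)
    (hA : a + e < 0) (hB : p + w < 0)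
    (hT : a*w + p*e - b*r - q*c = -2*d)
    (hM : (a+p)*(e+w) - (b+q)*(c+r) = 0) :
    ∃ y0 y1 z0 z1 : ℝ, y0*z1 - y1*z0 ≠ 0 ∧ ∀ x0 x1 : ℝ,
      d*(y0*x0+y1*x1)*(y0*(a*x0+b*x1)+y1*(c*x0+e*x1))
        + (z0*x0+z1*x1)*(z0*(a*x0+b*x1)+z1*(c*x0+e*x1)) ≤ 0 ∧
      d*(y0*x0+y1*x1)*(y0*(p*x0+q*x1)+y1*(r*x0+w*x1))
        + (z0*x0+z1*x1)*(z0*(p*x0+q*x1)+z1*(r*x0+w*x1)) ≤ 0 := by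
  by_cases hl : a + p ≠ 0 ∨ b + q ≠ 0
  · refine alg_row (a+p) (b+q) a b c e p q r w d hd hd0 (by linarith) hA hB hl ?_ ?_ ?_ ?_
    · linear_combination -hM
    · ring
    · subst hd
      linear_combination (a+p)*hT - a*hM
    · subst hd
      linear_combination (b+q)*hT - b*hM
  · push Not at hl
    have hl' : c + r ≠ 0 ∨ e + w ≠ 0 := by
      right; intro h; linarith
    refine alg_row (c+r) (e+w) a b c e p q r w d hd hd0 (by linarith) hA hB hl' ?_ ?_ ?_ ?_
    · ring
    · linear_combination -hM
    · subst hd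
      linear_combination (c+r)*hT - c*hM
    · subst hd
      linear_combination (e+w)*hT - e*hM

lemma sq_integral (f : ℝ → ℝ) (c t : ℝ) (hf : IntervalIntegrable f MeasureTheory.volume 0 t) :
    ∫ s in (0:ℝ)..t, 2 * (c + ∫ r in (0:ℝ)..s, f r) * f s
      = (c + ∫ r in (0:ℝ)..t, f r)^2 - c^2 := by
  have ac0 := hf.absolutelyContinuousOnInterval_intervalIntegral (c := 0) (by simp)
  have acc : AbsolutelyContinuousOnInterval (fun _ : ℝ => c) 0 t :=
    (LipschitzWith.const c).lipschitzOnWith.absolutelyContinuousOnInterval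
  have ac : AbsolutelyContinuousOnInterval (fun s => c + ∫ r in (0:ℝ)..s, f r) 0 t := acc.add ac0
  have h := ac.integral_deriv_mul_eq_sub ac
  simp only [intervalIntegral.integral_same, add_zero] at h
  rw [sq, sq, ← h]
  apply intervalIntegral.integral_congr_ae
  filter_upwards [hf.ae_hasDerivAt_integral] with x hx hx3
  have hx' := (hx (Set.uIoc_subset_uIcc hx3) 0 (by simp)).const_add c
  rw [hx'.deriv]; ring

lemma traj_integrable {A₁ A₂ : Matrix (Fin 2) (Fin 2) ℝ} {u : ℝ → ℝ} {γ : ℝ → Fin 2 → ℝ}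
    (hu : IsControl u) (hγ : Continuous γ) (a t : ℝ) :
    IntervalIntegrable (fun s => u s • A₁.mulVec (γ s) + (1 - u s) • A₂.mulVec (γ s))
      MeasureTheory.volume a t := by
  have hui : ∀ v : ℝ → ℝ, Measurable v → (∀ s, |v s| ≤ 1) →
      IntervalIntegrable v MeasureTheory.volume a t := by
    intro v hv hb
    rw [intervalIntegrable_iff]
    refine MeasureTheory.Measure.integrableOn_of_bounded (M := 1) (by simp)
      hv.aestronglyMeasurable (Filter.Eventually.of_forall (fun s => by simpa using hb s))
  have c1 : Continuous (fun s => A₁.mulVec (γ s)) := continuous_const.matrix_mulVec hγ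
  have c2 : Continuous (fun s => A₂.mulVec (γ s)) := continuous_const.matrix_mulVec hγ
  refine IntervalIntegrable.add ?_ ?_
  · exact (hui u hu.1 (fun s => by rcases hu.2 s with h | h <;> simp [h])).smul_continuousOn
      c1.continuousOn
  · exact (hui (fun s => 1 - u s) (measurable_const.sub hu.1)
      (fun s => by rcases hu.2 s with h | h <;> simp [h])).smul_continuousOn c2.continuousOn

lemma traj_functional {A₁ A₂ : Matrix (Fin 2) (Fin 2) ℝ} {u : ℝ → ℝ} {γ : ℝ → Fin 2 → ℝ}
    (hu : IsControl u) (hγ : IsTrajectory A₁ A₂ u γ) (L : (Fin 2 → ℝ) →L[ℝ] ℝ) :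
    (∀ t, IntervalIntegrable
      (fun s => L (u s • A₁.mulVec (γ s) + (1 - u s) • A₂.mulVec (γ s)))
      MeasureTheory.volume 0 t) ∧
    ∀ t, 0 ≤ t → L (γ t) = L (γ 0) + ∫ s in (0:ℝ)..t,
      L (u s • A₁.mulVec (γ s) + (1 - u s) • A₂.mulVec (γ s)) := by
  refine ⟨fun t => ?_, fun t ht => ?_⟩
  · have h := traj_integrable (A₁ := A₁) (A₂ := A₂) hu hγ.1 0 t
    rw [intervalIntegrable_iff] at h ⊢
    exact L.integrable_comp h
  · conv_lhs => rw [hγ.2 t ht]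
    rw [map_add, L.intervalIntegral_comp_comm (traj_integrable hu hγ.1 0 t)]

lemma lyap_s4 {A₁ A₂ : Matrix (Fin 2) (Fin 2) ℝ} (d : ℝ) (Y Z : (Fin 2 → ℝ) →L[ℝ] ℝ)
    (h1 : ∀ x, d * Y x * Y (A₁.mulVec x) + Z x * Z (A₁.mulVec x) ≤ 0)
    (h2 : ∀ x, d * Y x * Y (A₂.mulVec x) + Z x * Z (A₂.mulVec x) ≤ 0)
    {u : ℝ → ℝ} {γ : ℝ → Fin 2 → ℝ}
    (hu : IsControl u) (hγ : IsTrajectory A₁ A₂ u γ) (t : ℝ) (ht : 0 ≤ t) :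
    d * (Y (γ t))^2 + (Z (γ t))^2 ≤ d * (Y (γ 0))^2 + (Z (γ 0))^2 := by
  obtain ⟨iY, eY⟩ := traj_functional hu hγ Y
  obtain ⟨iZ, eZ⟩ := traj_functional hu hγ Z
  have sY := sq_integral _ (Y (γ 0)) t (iY t)
  have sZ := sq_integral _ (Z (γ 0)) t (iZ t)
  rw [← eY t ht] at sY
  rw [← eZ t ht] at sZ
  have cY : ∫ s in (0:ℝ)..t, 2 * (Y (γ 0) + ∫ r in (0:ℝ)..s, Y (u r • A₁.mulVec (γ r) + (1 - u r) • A₂.mulVec (γ r))) * Y (u s • A₁.mulVec (γ s) + (1 - u s) • A₂.mulVec (γ s))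
     = ∫ s in (0:ℝ)..t, 2 * Y (γ s) * Y (u s • A₁.mulVec (γ s) + (1 - u s) • A₂.mulVec (γ s)) := by
    apply intervalIntegral.integral_congr
    intro s hs
    rw [Set.uIcc_of_le ht] at hs
    simp only
    rw [← eY s hs.1]
  have cZ : ∫ s in (0:ℝ)..t, 2 * (Z (γ 0) + ∫ r in (0:ℝ)..s, Z (u r • A₁.mulVec (γ r) + (1 - u r) • A₂.mulVec (γ r))) * Z (u s • A₁.mulVec (γ s) + (1 - u s) • A₂.mulVec (γ s))
     = ∫ s in (0:ℝ)..t, 2 * Z (γ s) * Z (u s • A₁.mulVec (γ s) + (1 - u s) • A₂.mulVec (γ s)) := by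
    apply intervalIntegral.integral_congr
    intro s hs
    rw [Set.uIcc_of_le ht] at hs
    simp only
    rw [← eZ s hs.1]
  rw [cY] at sY
  rw [cZ] at sZ
  have jY := (iY t).continuousOn_mul (g := fun s => 2 * Y (γ s))
    (by have := hγ.1; fun_prop)
  have jZ := (iZ t).continuousOn_mul (g := fun s => 2 * Z (γ s))
    (by have := hγ.1; fun_prop)
  have hsum := intervalIntegral.integral_add (jY.const_mul d) jZ
  rw [intervalIntegral.integral_const_mul, sY, sZ] at hsum
  have hle : ∫ s in (0:ℝ)..t, (d * (2 * Y (γ s) * Y (u s • A₁.mulVec (γ s) + (1 - u s) • A₂.mulVec (γ s))) + 2 * Z (γ s) * Z (u s • A₁.mulVec (γ s) + (1 - u s) • A₂.mulVec (γ s))) ≤ 0 := by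
    rw [← neg_nonneg, ← intervalIntegral.integral_neg]
    apply intervalIntegral.integral_nonneg ht
    intro s _
    rcases hu.2 s with h | h
    · simp only [h, zero_smul, sub_zero, one_smul, zero_add]
      linarith [h2 (γ s)]
    · simp only [h, zero_smul, sub_self, one_smul, add_zero]
      linarith [h1 (γ s)]
  linarith

/-- Functional with coefficients `y0, y1`. -/
noncomputable def fnl (y0 y1 : ℝ) : (Fin 2 → ℝ) →L[ℝ] ℝ :=
  y0 • ContinuousLinearMap.proj (R := ℝ) (φ := fun _ : Fin 2 => ℝ) 0
    + y1 • ContinuousLinearMap.proj (R := ℝ) (φ := fun _ : Fin 2 => ℝ) 1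

lemma fnl_apply (y0 y1 : ℝ) (x : Fin 2 → ℝ) : fnl y0 y1 x = y0 * x 0 + y1 * x 1 := by
  simp [fnl]

lemma sq_bound (a b X Y n : ℝ) (hX : |X| ≤ n) (hY : |Y| ≤ n) :
    (a * X + b * Y)^2 ≤ (|a| + |b|)^2 * n^2 := by
  have hn : 0 ≤ n := (abs_nonneg X).trans hX
  rw [← mul_pow, sq_le_sq]
  rw [abs_of_nonneg (a := (|a| + |b|) * n) (by positivity)]
  calc |a * X + b * Y| ≤ |a * X| + |b * Y| := abs_add_le _ _
    _ = |a| * |X| + |b| * |Y| := by rw [abs_mul, abs_mul]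
    _ ≤ |a| * n + |b| * n := by gcongr
    _ = _ := by ring

lemma cs_bound (d a b Y Z : ℝ) (hd : 0 < d) :
    (a * Y + b * Z)^2 ≤ (a^2/d + b^2) * (d*Y^2 + Z^2) := by
  have : (a^2/d + b^2) * (d*Y^2 + Z^2) - (a * Y + b * Z)^2 = (a*Z - b*d*Y)^2/d := by
    field_simp; ring
  have h2 : 0 ≤ (a*Z - b*d*Y)^2/d := by positivity
  linarith

lemma traj_bound {A₁ A₂ : Matrix (Fin 2) (Fin 2) ℝ} (d : ℝ) (hd : 0 < d) (y0 y1 z0 z1 : ℝ)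
    (hΔ : y0*z1 - y1*z0 ≠ 0)
    (h1 : ∀ x, d * fnl y0 y1 x * fnl y0 y1 (A₁.mulVec x) + fnl z0 z1 x * fnl z0 z1 (A₁.mulVec x) ≤ 0)
    (h2 : ∀ x, d * fnl y0 y1 x * fnl y0 y1 (A₂.mulVec x) + fnl z0 z1 x * fnl z0 z1 (A₂.mulVec x) ≤ 0) :
    ∃ C > 0, ∀ u γ, IsControl u → IsTrajectory A₁ A₂ u γ →
      ∀ t ≥ (0:ℝ), ‖γ t‖ ≤ C * ‖γ 0‖ := by
  set Δ := y0*z1 - y1*z0 with hΔd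
  set V := d * (|y0|+|y1|)^2 + (|z0|+|z1|)^2 with hV
  set K := ((z1^2/d + y1^2) + (z0^2/d + y0^2)) * V / Δ^2 with hK
  have hV0 : 0 ≤ V := by positivity
  have hK0 : 0 ≤ K := by positivity
  refine ⟨K + 1, by positivity, ?_⟩
  intro u γ hu hγ t ht
  have hl := lyap_s4 d _ _ h1 h2 hu hγ t ht
  simp only [fnl_apply] at hl
  set n := ‖γ 0‖
  have n0 : |γ 0 0| ≤ n := norm_le_pi_norm (γ 0) 0
  have n1 : |γ 0 1| ≤ n := norm_le_pi_norm (γ 0) 1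
  have b0 : d * (y0 * γ 0 0 + y1 * γ 0 1)^2 + (z0 * γ 0 0 + z1 * γ 0 1)^2 ≤ V * n^2 := by
    have e1 := sq_bound y0 y1 _ _ n n0 n1
    have e2 := sq_bound z0 z1 _ _ n n0 n1
    have e3 := mul_le_mul_of_nonneg_left e1 hd.le
    rw [hV]; linarith
  have bt := hl.trans b0
  set P := y0 * γ t 0 + y1 * γ t 1 with hP
  set Q := z0 * γ t 0 + z1 * γ t 1 with hQ
  have hΔ2 : 0 < Δ^2 := by positivity
  have x0 : (γ t 0)^2 ≤ K * n^2 := by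
    have e1 := cs_bound d z1 (-y1) P Q hd
    have e2 : z1 * P + (-y1) * Q = Δ * γ t 0 := by rw [hP, hQ, hΔd]; ring
    rw [e2] at e1
    have e3 : (z1^2/d + (-y1)^2) * (d*P^2+Q^2) ≤ ((z1^2/d + y1^2) + (z0^2/d + y0^2)) * (V*n^2) := by
      apply mul_le_mul _ bt (by positivity) (by positivity)
      have : 0 ≤ z0^2/d + y0^2 := by positivity
      rw [neg_sq]; linarith
    have e4 : K * n^2 = ((z1^2/d + y1^2) + (z0^2/d + y0^2)) * (V*n^2) / Δ^2 := by rw [hK]; ring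
    rw [e4, le_div_iff₀ hΔ2]
    linarith
  have x1 : (γ t 1)^2 ≤ K * n^2 := by
    have e1 := cs_bound d (-z0) y0 P Q hd
    have e2 : (-z0) * P + y0 * Q = Δ * γ t 1 := by rw [hP, hQ, hΔd]; ring
    rw [e2] at e1
    have e3 : ((-z0)^2/d + y0^2) * (d*P^2+Q^2) ≤ ((z1^2/d + y1^2) + (z0^2/d + y0^2)) * (V*n^2) := by
      apply mul_le_mul _ bt (by positivity) (by positivity)
      have : 0 ≤ z1^2/d + y1^2 := by positivity
      rw [neg_sq]; linarith
    have e4 : K * n^2 = ((z1^2/d + y1^2) + (z0^2/d + y0^2)) * (V*n^2) / Δ^2 := by rw [hK]; ring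
    rw [e4, le_div_iff₀ hΔ2]
    linarith
  have hn : 0 ≤ n := norm_nonneg _
  have hKK : K * n^2 ≤ ((K+1)*n)^2 := by
    have : 0 ≤ (K^2 + K + 1) * n^2 := by positivity
    linarith
  rw [pi_norm_le_iff_of_nonneg (by positivity)]
  intro i
  rw [Real.norm_eq_abs]
  apply abs_le_of_sq_le_sq _ (by positivity)
  fin_cases i
  · exact x0.trans hKK
  · exact x1.trans hKK

/-- The matrix as a continuous linear map. -/
noncomputable def cl (A : Matrix (Fin 2) (Fin 2) ℝ) : (Fin 2 → ℝ) →L[ℝ] (Fin 2 → ℝ) :=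
  LinearMap.toContinuousLinearMap (Matrix.mulVecLin A)

lemma cl_apply (A : Matrix (Fin 2) (Fin 2) ℝ) (x : Fin 2 → ℝ) : cl A x = A.mulVec x := rfl

/-- The flow of a linear system. -/
noncomputable def flow (A : Matrix (Fin 2) (Fin 2) ℝ) (t : ℝ) : (Fin 2 → ℝ) →L[ℝ] (Fin 2 → ℝ) :=
  NormedSpace.exp (t • cl A)

lemma flow_zero (A : Matrix (Fin 2) (Fin 2) ℝ) : flow A 0 = 1 := by
  simp [flow]

lemma flow_hasDerivAt (A : Matrix (Fin 2) (Fin 2) ℝ) (t : ℝ) :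
    HasDerivAt (flow A) (cl A * flow A t) t :=
  hasDerivAt_exp_smul_const' (𝕂 := ℝ) (cl A) t

lemma flow_hasDerivAt_apply (A : Matrix (Fin 2) (Fin 2) ℝ) (x : Fin 2 → ℝ) (t : ℝ) :
    HasDerivAt (fun t => flow A t x) (A.mulVec (flow A t x)) t := by
  have := (flow_hasDerivAt A t).clm_apply (hasDerivAt_const t x)
  simpa [cl_apply] using this

lemma flow_continuous (A : Matrix (Fin 2) (Fin 2) ℝ) (x : Fin 2 → ℝ) :
    Continuous (fun t => flow A t x) :=
  continuous_iff_continuousAt.2 fun t => (flow_hasDerivAt_apply A x t).continuousAt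

lemma flow_integral (A : Matrix (Fin 2) (Fin 2) ℝ) (x : Fin 2 → ℝ) (T t : ℝ) :
    ∫ s in T..t, A.mulVec (flow A (s - T) x) = flow A (t - T) x - x := by
  have hc : Continuous fun s => A.mulVec (flow A (s - T) x) :=
    continuous_const.matrix_mulVec ((flow_continuous A x).comp (by fun_prop))
  rw [intervalIntegral.integral_eq_sub_of_hasDerivAt (f := fun s => flow A (s - T) x)]
  · simp [flow_zero]
  · intro s _
    exact (flow_hasDerivAt_apply A x (s - T)).comp_sub_const s T
  · exact hc.intervalIntegrable _ _

/-- `y` can be reached from `x` at time `T`. -/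
def Reach (A₁ A₂ : Matrix (Fin 2) (Fin 2) ℝ) (x y : Fin 2 → ℝ) (T : ℝ) : Prop :=
  ∃ u γ, IsControl u ∧ IsTrajectory A₁ A₂ u γ ∧ γ 0 = x ∧ γ T = y

lemma reach_refl (A₁ A₂ : Matrix (Fin 2) (Fin 2) ℝ) (x : Fin 2 → ℝ) : Reach A₁ A₂ x x 0 := by
  refine ⟨fun _ => 1, fun t => flow A₁ t x, ⟨measurable_const, fun _ => Or.inr rfl⟩,
    ⟨flow_continuous A₁ x, ?_⟩, by simp [flow_zero], by simp [flow_zero]⟩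
  intro t _
  have := flow_integral A₁ x 0 t
  simp only [sub_zero] at this
  simp only [one_smul, sub_self, zero_smul, add_zero, this, flow_zero]
  simp

lemma reach_step (A₁ A₂ A : Matrix (Fin 2) (Fin 2) ℝ) (c : ℝ) (hc : c = 0 ∨ c = 1)
    (hA : ∀ x, c • A₁.mulVec x + (1 - c) • A₂.mulVec x = A.mulVec x)
    (x y : Fin 2 → ℝ) (T h : ℝ) (hT : 0 ≤ T) (hh : 0 ≤ h) (hr : Reach A₁ A₂ x y T) :
    Reach A₁ A₂ x (flow A h y) (T + h) := by
  obtain ⟨u, γ, hu, hγ, h0, h1⟩ := hr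
  have hγ'c : Continuous (fun t => if t ≤ T then γ t else flow A (t - T) y) := by
    refine Continuous.if_le hγ.1 ((flow_continuous A y).comp (by fun_prop)) continuous_id
      continuous_const ?_
    intro t ht
    have ht' : t = T := ht
    subst ht'
    simp [flow_zero, h1]
  have hu' : IsControl (fun t => if t < T then u t else c) := by
    refine ⟨Measurable.ite measurableSet_Iio hu.1 measurable_const, fun t => ?_⟩
    by_cases ht : t < T
    · simp only [ht, if_true]; exact hu.2 t
    · simp only [ht, if_false]; exact hc
  have hI := fun a t => traj_integrable (A₁ := A₁) (A₂ := A₂) hu' hγ'c a t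
  refine ⟨_, _, hu', ⟨hγ'c, ?_⟩, by simp [hT, h0], ?_⟩
  · have key : ∀ t, 0 ≤ t → t ≤ T → γ t = γ 0 + ∫ s in (0:ℝ)..t,
        ((if s < T then u s else c) • A₁.mulVec (if s ≤ T then γ s else flow A (s - T) y)
        + (1 - (if s < T then u s else c)) • A₂.mulVec (if s ≤ T then γ s else flow A (s - T) y)) := by
      intro t ht htT
      conv_lhs => rw [hγ.2 t ht]
      congr 1
      apply intervalIntegral.integral_congr_ae
      have hne : ∀ᵐ s : ℝ, s ≠ T := by simp [MeasureTheory.ae_iff, MeasureTheory.measure_singleton]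
      filter_upwards [hne] with s hs hs2
      rw [Set.uIoc_of_le ht] at hs2
      have h3 : s ≤ T := hs2.2.trans htT
      simp only [h3, lt_of_le_of_ne h3 hs, if_true]
    intro t ht
    simp only [hT, if_true]
    by_cases htT : t ≤ T
    · simp only [htT, if_true]
      exact key t ht htT
    · simp only [htT, if_false]
      push Not at htT
      rw [← intervalIntegral.integral_add_adjacent_intervals (hI 0 T) (hI T t), ← add_assoc,
        ← key T hT le_rfl, h1]
      have : ∫ s in T..t,
        ((if s < T then u s else c) • A₁.mulVec (if s ≤ T then γ s else flow A (s - T) y)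
        + (1 - (if s < T then u s else c)) • A₂.mulVec (if s ≤ T then γ s else flow A (s - T) y))
          = ∫ s in T..t, A.mulVec (flow A (s - T) y) := by
        apply intervalIntegral.integral_congr_ae
        refine Filter.Eventually.of_forall fun s hs2 => ?_
        rw [Set.uIoc_of_le htT.le] at hs2
        simp only [not_le.2 hs2.1, not_lt.2 hs2.1.le, if_false]
        exact hA _
      rw [this, flow_integral]
      simp
  · rcases hh.eq_or_lt with rfl | hh
    · simp [flow_zero, h1]
    · simp [hh]

/-- One period. -/
noncomputable def per (A₁ A₂ : Matrix (Fin 2) (Fin 2) ℝ) (s h : ℝ) :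
    (Fin 2 → ℝ) →L[ℝ] (Fin 2 → ℝ) := flow A₂ (s * h) * flow A₁ h

lemma reach_per (A₁ A₂ : Matrix (Fin 2) (Fin 2) ℝ) (s h : ℝ) (hs : 0 ≤ s) (hh : 0 ≤ h)
    (x : Fin 2 → ℝ) (n : ℕ) :
    Reach A₁ A₂ x ((per A₁ A₂ s h ^ n) x) (n * (h + s * h)) := by
  induction n with
  | zero => simpa using reach_refl A₁ A₂ x
  | succ n ih =>
    have e1 := reach_step A₁ A₂ A₁ 1 (Or.inr rfl) (by simp) x _ _ h (by positivity) hh ih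
    have e2 := reach_step A₁ A₂ A₂ 0 (Or.inl rfl) (by simp) x _ _ (s*h) (by positivity)
      (by positivity) e1
    have e3 : (per A₁ A₂ s h ^ (n+1)) x = flow A₂ (s*h) (flow A₁ h ((per A₁ A₂ s h ^ n) x)) := by
      rw [pow_succ']; rfl
    rw [e3]
    convert e2 using 1
    push_cast; ring

lemma per_littleO (A₁ A₂ : Matrix (Fin 2) (Fin 2) ℝ) (s : ℝ) (v : Fin 2 → ℝ)
    (hv : A₁.mulVec v + s • A₂.mulVec v = 0) :
    HasDerivAt (fun h => per A₁ A₂ s h v) 0 0 := by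
  have d1 := flow_hasDerivAt_apply A₁ v 0
  have d2 : HasDerivAt (fun h => flow A₂ (s * h)) (s • (cl A₂ * flow A₂ (s * 0))) 0 := by
    have := HasDerivAt.scomp (0:ℝ) (flow_hasDerivAt A₂ (s*0)) ((hasDerivAt_id (0:ℝ)).const_mul s)
    exact (by simpa using this :
      HasDerivAt (flow A₂ ∘ HMul.hMul s) (s • (cl A₂ * flow A₂ (s * 0))) 0)
  have := d2.clm_apply d1
  simp only [mul_zero, flow_zero, mul_one, _root_.smul_apply, cl_apply,
    one_apply_eq_self] at this
  rw [add_comm, hv] at this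
  exact this

lemma per_pow_bound (A₁ A₂ : Matrix (Fin 2) (Fin 2) ℝ) (C : ℝ)
    (hC : ∀ u γ, IsControl u → IsTrajectory A₁ A₂ u γ → ∀ t ≥ (0:ℝ), ‖γ t‖ ≤ C * ‖γ 0‖)
    (s h : ℝ) (hs : 0 ≤ s) (hh : 0 ≤ h) (v : Fin 2 → ℝ) (n : ℕ) :
    ‖(per A₁ A₂ s h ^ n) v - v‖ ≤ n * (C * ‖per A₁ A₂ s h v - v‖) := by
  induction n with
  | zero => simp
  | succ n ih =>
    have e : (per A₁ A₂ s h ^ (n+1)) v - v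
        = (per A₁ A₂ s h ^ n) (per A₁ A₂ s h v - v) + ((per A₁ A₂ s h ^ n) v - v) := by
      rw [pow_succ, map_sub]
      simp
    obtain ⟨u, γ, hu, hγ, g0, g1⟩ := reach_per A₁ A₂ s h hs hh (per A₁ A₂ s h v - v) n
    have b := hC u γ hu hγ (n * (h + s * h)) (by positivity)
    rw [g0, g1] at b
    rw [e]
    refine (norm_add_le _ _).trans ((add_le_add b ih).trans (le_of_eq ?_))
    rw [Nat.cast_succ]
    ring

lemma not_guas (A₁ A₂ : Matrix (Fin 2) (Fin 2) ℝ) (C : ℝ) (hC0 : 0 < C)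
    (hC : ∀ u γ, IsControl u → IsTrajectory A₁ A₂ u γ → ∀ t ≥ (0:ℝ), ‖γ t‖ ≤ C * ‖γ 0‖)
    (s : ℝ) (hs : 0 ≤ s) (v : Fin 2 → ℝ) (hv0 : v ≠ 0)
    (hv : A₁.mulVec v + s • A₂.mulVec v = 0) : ¬ GUAS A₁ A₂ := by
  rintro ⟨-, hG⟩
  have hn : 0 < ‖v‖ := norm_pos_iff.2 hv0
  obtain ⟨T, hT, hG⟩ := hG (‖v‖/2) (by positivity) ‖v‖ hn
  have hd := (per_littleO A₁ A₂ s v hv).isLittleO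
  have hper0 : per A₁ A₂ s 0 v = v := by simp [per, flow_zero]
  simp only [hper0, smul_zero, sub_zero] at hd
  have hc : 0 < ‖v‖ / (4 * C * T) := by positivity
  have hev := hd.bound hc
  rw [Metric.eventually_nhds_iff] at hev
  obtain ⟨η, hη, hev⟩ := hev
  obtain ⟨n, hn1⟩ := exists_nat_gt (T / η)
  have hnpos : (0:ℝ) < n := lt_of_le_of_lt (by positivity) hn1
  have hh : 0 < T / n := by positivity
  have hlt : T / n < η := by
    rw [div_lt_iff₀ hη] at hn1
    rw [div_lt_iff₀ hnpos]; linarith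
  have hb := hev (y := T / n) (by rw [Real.dist_eq, sub_zero, abs_of_pos hh]; exact hlt)
  rw [Real.norm_eq_abs, abs_of_pos hh] at hb
  have hp := per_pow_bound A₁ A₂ C hC s (T/n) hs hh.le v n
  have hp2 : ‖(per A₁ A₂ s (T/n) ^ n) v - v‖ ≤ ‖v‖/4 := by
    refine hp.trans ?_
    calc n * (C * ‖per A₁ A₂ s (T/n) v - v‖) ≤ n * (C * (‖v‖ / (4 * C * T) * (T/n))) := by gcongr
      _ = ‖v‖/4 := by field_simp
  obtain ⟨u, γ, hu, hγ, g0, g1⟩ := reach_per A₁ A₂ s (T/n) hs hh.le v n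
  have hTn : T ≤ n * (T/n + s * (T/n)) := by
    have : n * (T/n + s * (T/n)) = T + s * T := by field_simp
    rw [this]
    have := mul_nonneg hs hT.le
    linarith
  have hfin := hG u γ hu hγ (by rw [g0]) _ hTn
  rw [g1] at hfin
  have := norm_sub_norm_le v ((per A₁ A₂ s (T/n) ^ n) v)
  rw [norm_sub_rev] at this
  linarith

theorem stmt_4 (A₁ A₂ : Matrix (Fin 2) (Fin 2) ℝ)
    (h₁ : Hurwitz A₁) (h₂ : Hurwitz A₂)
    (hΓ : Gam A₁ A₂ = - Real.sqrt (A₁.det * A₂.det)) :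
    UniformlyStable A₁ A₂ ∧ ¬ GUAS A₁ A₂ := by
  obtain ⟨ht1, hd1⟩ := h₁
  obtain ⟨ht2, hd2⟩ := h₂
  set d := A₁.det with hdd
  set d2 := A₂.det with hdd2
  set s := Real.sqrt (d / d2) with hsd
  have hs : 0 < s := Real.sqrt_pos.2 (by positivity)
  have hss : s^2 * d2 = d := by
    rw [hsd, Real.sq_sqrt (by positivity)]; field_simp
  have hsq : Real.sqrt (d * d2) = s * d2 := by
    rw [← hss, show s^2*d2*d2 = (s*d2)^2 by ring]
    exact Real.sqrt_sq (by positivity)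
  rw [hsq] at hΓ
  simp only [Gam, Matrix.trace_fin_two, Matrix.mul_apply, Fin.sum_univ_two] at hΓ
  rw [Matrix.trace_fin_two] at ht1 ht2
  rw [Matrix.det_fin_two] at hdd hdd2
  have hT : A₁ 0 0 * (s * A₂ 1 1) + (s * A₂ 0 0) * A₁ 1 1 - A₁ 0 1 * (s * A₂ 1 0)
      - (s * A₂ 0 1) * A₁ 1 0 = -2 * d := by
    linear_combination 2 * s * hΓ - 2 * hss
  have hM : (A₁ 0 0 + s * A₂ 0 0) * (A₁ 1 1 + s * A₂ 1 1)
      - (A₁ 0 1 + s * A₂ 0 1) * (A₁ 1 0 + s * A₂ 1 0) = 0 := by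
    linear_combination hT - hdd - s^2 * hdd2 + hss
  obtain ⟨y0, y1, z0, z1, hΔ, hdis⟩ := alg_main (A₁ 0 0) (A₁ 0 1) (A₁ 1 0) (A₁ 1 1)
    (s * A₂ 0 0) (s * A₂ 0 1) (s * A₂ 1 0) (s * A₂ 1 1) d hdd hd1 ht1
    (by rw [← mul_add]; exact mul_neg_of_pos_of_neg hs ht2) hT hM
  obtain ⟨C, hC0, hC⟩ := traj_bound (A₁ := A₁) (A₂ := A₂) d hd1 y0 y1 z0 z1 hΔ
    (by
      intro x
      have := (hdis (x 0) (x 1)).1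
      simpa [fnl_apply, Matrix.mulVec, dotProduct, Fin.sum_univ_two] using this)
    (by
      intro x
      have := (hdis (x 0) (x 1)).2
      simp only [fnl_apply, Matrix.mulVec, dotProduct, Fin.sum_univ_two]
      refine nonpos_of_mul_nonpos_right ?_ hs
      linarith)
  constructor
  · intro ε hε
    refine ⟨ε / C, by positivity, ?_⟩
    intro u γ hu hγ h0 t ht
    refine (hC u γ hu hγ t ht).trans ?_
    rw [le_div_iff₀ hC0] at h0
    linarith
  · have hdet : (A₁ + s • A₂).det = 0 := by
      rw [Matrix.det_fin_two]
      simpa using hM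
    obtain ⟨v, hv0, hv⟩ := Matrix.exists_mulVec_eq_zero_iff.2 hdet
    rw [Matrix.add_mulVec, Matrix.smul_mulVec] at hv
    exact not_guas A₁ A₂ C hC0 hC s hs.le v hv0 hv
end

section
/- Let A₁ and A₂ be Hurwitz real 2×2 matrices with det([A₁,A₂]) < 0, where [A₁,A₂] = A₁A₂ − A₂A₁. If Γ(A₁,A₂) = −√(det(A₁)det(A₂)), then there exists a nonstrict common quadratic Lyapunov function: a symmetric positive definite real 2×2 matrix P such that both A₁ᵀP + PA₁ and A₂ᵀP + PA₂ are negative semidefinite. -/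
open Matrix

/-- A positive semidefiniteness criterion for singular symmetric 2×2 matrices. -/
lemma psd_aux (M : Matrix (Fin 2) (Fin 2) ℝ) (hs : M 1 0 = M 0 1) (h0 : 0 ≤ M 0 0)
    (h1 : 0 ≤ M 1 1) (hd : M 0 0 * M 1 1 = M 0 1 ^ 2) : M.PosSemidef := by
  refine Matrix.PosSemidef.of_dotProduct_mulVec_nonneg ?_ ?_
  · ext i j
    fin_cases i <;> fin_cases j <;> simp [hs]
  · intro x
    simp only [dotProduct, mulVec, Fin.sum_univ_two, Pi.star_apply, star_trivial, hs]
    rcases h0.eq_or_lt with h | h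
    · have hb : M 0 1 = 0 := by
        rw [← h, zero_mul] at hd
        exact pow_eq_zero_iff (two_ne_zero) |>.1 hd.symm
      rw [← h, hb]
      nlinarith [mul_nonneg h1 (sq_nonneg (x 1))]
    · refine nonneg_of_mul_nonneg_right (a := M 0 0) ?_ h
      have : M 0 0 * (x 0 * (M 0 0 * x 0 + M 0 1 * x 1) + x 1 * (M 0 1 * x 0 + M 1 1 * x 1))
          = (M 0 0 * x 0 + M 0 1 * x 1) ^ 2 := by
        linear_combination (x 1) ^ 2 * hd
      rw [this]
      positivity

lemma pd_aux (p q r : ℝ) (hp : 0 < p) (hd : 0 < p * r - q ^ 2) :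
    (!![p, q; q, r] : Matrix (Fin 2) (Fin 2) ℝ).PosDef := by
  refine Matrix.PosDef.of_dotProduct_mulVec_pos ?_ ?_
  · ext i j
    fin_cases i <;> fin_cases j <;> simp
  · intro x hx
    simp only [dotProduct, mulVec, Fin.sum_univ_two, Pi.star_apply, star_trivial]
    simp
    refine pos_of_mul_pos_right (a := p) ?_ hp.le
    have : p * (x 0 * (p * x 0 + q * x 1) + x 1 * (q * x 0 + r * x 1))
        = (p * x 0 + q * x 1) ^ 2 + (p * r - q ^ 2) * (x 1) ^ 2 := by ring
    rw [this]
    by_cases h : x 1 = 0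
    · have h0 : x 0 ≠ 0 := by
        intro h0
        apply hx
        ext i
        fin_cases i <;> simp [h, h0]
      rw [h]
      have := mul_pos hp hp
      have := sq_pos_of_ne_zero h0
      simp
      positivity
    · have := sq_pos_of_ne_zero h
      positivity

lemma sgn_aux (p q r a b c : ℝ) (hp : 0 < p) (hd : 0 < p * r - q ^ 2) (hs : a * c = b ^ 2)
    (ht : r * a - 2 * q * b + p * c < 0) : a ≤ 0 := by
  by_contra! h
  have h1 : a * (r * a - 2 * q * b + p * c) < 0 := mul_neg_of_pos_of_neg h ht
  have h2 : p * (a * (r * a - 2 * q * b + p * c)) < 0 := mul_neg_of_pos_of_neg hp h1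
  have h3 : p * (a * (r * a - 2 * q * b + p * c))
      = (p * r - q ^ 2) * a ^ 2 + (q * a - p * b) ^ 2 := by
    linear_combination p ^ 2 * hs
  have : 0 ≤ (p * r - q ^ 2) * a ^ 2 + (q * a - p * b) ^ 2 := by positivity
  linarith

lemma lyap_aux (p q r : ℝ) (A : Matrix (Fin 2) (Fin 2) ℝ) (hp : 0 < p) (hd : 0 < p * r - q ^ 2)
    (ht : A 0 0 + A 1 1 < 0)
    (hs : (2 * (p * A 0 0 + q * A 1 0)) * (2 * (q * A 0 1 + r * A 1 1)) =
      (p * A 0 1 + q * A 1 1 + q * A 0 0 + r * A 1 0) ^ 2) :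
    (-(Aᵀ * !![p, q; q, r] + !![p, q; q, r] * A)).PosSemidef := by
  have hr : 0 < r := by
    by_contra! h
    nlinarith [mul_nonneg hp.le (neg_nonneg.2 h), sq_nonneg q]
  have hT : (A 0 0 + A 1 1) * (p * r - q ^ 2) < 0 := mul_neg_of_neg_of_pos ht hd
  have e0 := sgn_aux p q r _ _ _ hp hd hs (by linarith)
  have e1 := sgn_aux r q p _ _ _ hr (by linarith) ((mul_comm _ _).trans hs) (by linarith)
  apply psd_aux
  · simp [Matrix.mul_apply, Fin.sum_univ_two, Matrix.vecMul, dotProduct]; ring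
  · simp [Matrix.mul_apply, Fin.sum_univ_two, Matrix.vecMul, dotProduct]; linarith
  · simp [Matrix.mul_apply, Fin.sum_univ_two, Matrix.vecMul, dotProduct]; linarith
  · simp [Matrix.mul_apply, Fin.sum_univ_two, Matrix.vecMul, dotProduct]; linear_combination hs

theorem stmt_5 (A₁ A₂ : Matrix (Fin 2) (Fin 2) ℝ)
    (h₁ : Hurwitz A₁) (h₂ : Hurwitz A₂)
    (hcomm : (A₁ * A₂ - A₂ * A₁).det < 0)
    (hΓ : Gam A₁ A₂ = - Real.sqrt (A₁.det * A₂.det)) :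
    ∃ P : Matrix (Fin 2) (Fin 2) ℝ, P.IsSymm ∧ P.PosDef ∧
      (-(A₁ᵀ * P + P * A₁)).PosSemidef ∧ (-(A₂ᵀ * P + P * A₂)).PosSemidef := by
  obtain ⟨t1, d1⟩ := h₁
  obtain ⟨t2, d2⟩ := h₂
  have hG : Gam A₁ A₂ ^ 2 = A₁.det * A₂.det := by
    rw [hΓ, neg_sq, Real.sq_sqrt (mul_pos d1 d2).le]
  clear hΓ
  simp only [Gam, Matrix.trace_fin_two, Matrix.det_fin_two, Matrix.mul_apply, Fin.sum_univ_two,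
    Matrix.sub_apply] at hG hcomm t1 t2
  clear d1 d2
  -- `P = ± J N` with `N = tr(A₂) A₁ - tr(A₁) A₂`
  have key : ∀ k : ℝ, k ^ 2 = 1 →
      0 < k * ((A₂ 0 0 + A₂ 1 1) * A₁ 1 0 - (A₁ 0 0 + A₁ 1 1) * A₂ 1 0) →
      ∃ P : Matrix (Fin 2) (Fin 2) ℝ, P.IsSymm ∧ P.PosDef ∧
      (-(A₁ᵀ * P + P * A₁)).PosSemidef ∧ (-(A₂ᵀ * P + P * A₂)).PosSemidef := by
    intro k hk hpos
    obtain ⟨p, hp⟩ : ∃ p, p = k * ((A₂ 0 0 + A₂ 1 1) * A₁ 1 0 - (A₁ 0 0 + A₁ 1 1) * A₂ 1 0) :=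
      ⟨_, rfl⟩
    obtain ⟨q, hq⟩ : ∃ q, q = -k * ((A₂ 0 0 + A₂ 1 1) * A₁ 0 0 - (A₁ 0 0 + A₁ 1 1) * A₂ 0 0) :=
      ⟨_, rfl⟩
    obtain ⟨r, hr⟩ : ∃ r, r = -k * ((A₂ 0 0 + A₂ 1 1) * A₁ 0 1 - (A₁ 0 0 + A₁ 1 1) * A₂ 0 1) :=
      ⟨_, rfl⟩
    rw [← hp] at hpos
    have hd : 0 < p * r - q ^ 2 := by
      refine lt_of_lt_of_eq (neg_pos.2 hcomm) ?_
      rw [hp, hq, hr]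
      linear_combination 4 * hG + (((A₂ 0 0 + A₂ 1 1) * A₁ 1 0 - (A₁ 0 0 + A₁ 1 1) * A₂ 1 0) *
        ((A₂ 0 0 + A₂ 1 1) * A₁ 0 1 - (A₁ 0 0 + A₁ 1 1) * A₂ 0 1) +
        ((A₂ 0 0 + A₂ 1 1) * A₁ 0 0 - (A₁ 0 0 + A₁ 1 1) * A₂ 0 0) ^ 2) * hk
    refine ⟨!![p, q; q, r], ?_, pd_aux p q r hpos hd, lyap_aux p q r A₁ hpos hd t1 ?_,
      lyap_aux p q r A₂ hpos hd t2 ?_⟩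
    · ext i j
      fin_cases i <;> fin_cases j <;> simp
    · rw [hp, hq, hr]
      linear_combination (-4) * k ^ 2 * (A₁ 0 0 + A₁ 1 1) ^ 2 * hG
    · rw [hp, hq, hr]
      linear_combination (-4) * k ^ 2 * (A₂ 0 0 + A₂ 1 1) ^ 2 * hG
  rcases lt_trichotomy ((A₂ 0 0 + A₂ 1 1) * A₁ 1 0 - (A₁ 0 0 + A₁ 1 1) * A₂ 1 0) 0 with h | h | h
  · exact key (-1) (by norm_num) (by linarith)
  · exfalso
    have h2 := sq_nonneg ((A₂ 0 0 + A₂ 1 1) * A₁ 0 0 - (A₁ 0 0 + A₁ 1 1) * A₂ 0 0)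
    have h3 : ((A₂ 0 0 + A₂ 1 1) * A₁ 1 0 - (A₁ 0 0 + A₁ 1 1) * A₂ 1 0) *
      ((A₂ 0 0 + A₂ 1 1) * A₁ 0 1 - (A₁ 0 0 + A₁ 1 1) * A₂ 0 1) = 0 := by rw [h, zero_mul]
    linarith
  · exact key 1 (by norm_num) (by linarith)
end

section
/- Let A₁ and A₂ be Hurwitz real 2×2 matrices such that the commutator [A₁,A₂] = A₁A₂ − A₂A₁ has rank 1. Then, possibly after exchanging A₁ and A₂, there exists an invertible real 2×2 matrix T such that T⁻¹A₁T is diagonal and T⁻¹A₂T is upper triangular. -/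
open Matrix

lemma aux_diag (A B S T : Matrix (Fin 2) (Fin 2) ℝ) (hST : S * T = 1)
    (hA : (S * A * T) 1 0 = 0) (hB : (S * B * T) 1 0 = 0)
    (hne : (S * A * T) 0 0 ≠ (S * A * T) 1 1) :
    ∃ T : Matrix (Fin 2) (Fin 2) ℝ, IsUnit T ∧
        (T⁻¹ * A * T).IsDiag ∧ Matrix.BlockTriangular (T⁻¹ * B * T) id := by
  set U := S * A * T with hU
  set V := S * B * T with hV
  obtain ⟨x, hx⟩ : ∃ x : ℝ, U 0 0 * x + U 0 1 - x * U 1 1 = 0 := by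
    have : U 0 0 - U 1 1 ≠ 0 := sub_ne_zero.mpr hne
    refine ⟨-U 0 1 / (U 0 0 - U 1 1), ?_⟩
    field_simp
    ring
  have hP : !![1, -x; 0, 1] * !![1, x; 0, 1] = (1 : Matrix (Fin 2) (Fin 2) ℝ) := by
    ext i j; fin_cases i <;> fin_cases j <;> simp [Matrix.mul_apply, Matrix.vecMul, dotProduct, Fin.sum_univ_two]
  have h1 : (!![1, -x; 0, 1] * S) * (T * !![1, x; 0, 1]) = 1 := by
    calc _ = !![1, -x; 0, 1] * (S * T) * !![1, x; 0, 1] := by simp only [Matrix.mul_assoc]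
      _ = 1 := by rw [hST, Matrix.mul_one, hP]
  have hinv := Matrix.inv_eq_left_inv h1
  refine ⟨T * !![1, x; 0, 1], ?_, ?_, ?_⟩
  · exact (Matrix.isUnit_iff_isUnit_det _).2 (Matrix.isUnit_det_of_left_inverse h1)
  · have : (T * !![1, x; 0, 1])⁻¹ * A * (T * !![1, x; 0, 1])
        = !![1, -x; 0, 1] * U * !![1, x; 0, 1] := by
      rw [hinv, hU]; simp only [Matrix.mul_assoc]
    rw [this]
    intro i j hij
    fin_cases i <;> fin_cases j <;>
      simp [Matrix.mul_apply, Matrix.vecMul, dotProduct, Fin.sum_univ_two, hA] at hij ⊢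
    linarith
  · have : (T * !![1, x; 0, 1])⁻¹ * B * (T * !![1, x; 0, 1])
        = !![1, -x; 0, 1] * V * !![1, x; 0, 1] := by
      rw [hinv, hV]; simp only [Matrix.mul_assoc]
    rw [this]
    intro i j hij
    fin_cases i <;> fin_cases j <;>
      simp [Matrix.mul_apply, Matrix.vecMul, dotProduct, Fin.sum_univ_two, hB] at hij ⊢

lemma aux_tri (A B : Matrix (Fin 2) (Fin 2) ℝ) (hC : A * B - B * A ≠ 0)
    (hdet : (A * B - B * A).det = 0) :
    ∃ S T : Matrix (Fin 2) (Fin 2) ℝ, S * T = 1 ∧ (S * A * T) 1 0 = 0 ∧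
      (S * B * T) 1 0 = 0 := by
  set C := A * B - B * A with hCd
  obtain ⟨p, hp⟩ : ∃ p, p = C 0 0 := ⟨_, rfl⟩
  obtain ⟨q, hq⟩ : ∃ q, q = C 0 1 := ⟨_, rfl⟩
  obtain ⟨r, hr⟩ : ∃ r, r = C 1 0 := ⟨_, rfl⟩
  have hs : C 1 1 = -p := by
    rw [hp, hCd]; simp [Matrix.mul_apply, Matrix.vecMul, dotProduct, Fin.sum_univ_two]; ring
  have hd : p * p + q * r = 0 := by
    rw [Matrix.det_fin_two, hs, ← hp, ← hq, ← hr] at hdet; linarith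
  have tA : A 0 0 * p + A 0 1 * r + A 1 0 * q - A 1 1 * p = 0 := by
    rw [hp, hq, hr, hCd]; simp [Matrix.mul_apply, Matrix.vecMul, dotProduct, Fin.sum_univ_two]; ring
  have tB : B 0 0 * p + B 0 1 * r + B 1 0 * q - B 1 1 * p = 0 := by
    rw [hp, hq, hr, hCd]; simp [Matrix.mul_apply, Matrix.vecMul, dotProduct, Fin.sum_univ_two]; ring
  clear_value C
  by_cases h0 : r = 0
  · have p0 : p = 0 := by rw [h0] at hd; simpa using hd
    have q0 : q ≠ 0 := by
      intro q0
      apply hC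
      ext i j
      fin_cases i <;> fin_cases j <;> simp [← hp, ← hq, ← hr, hs, p0, q0, h0]
    refine ⟨1, 1, by simp, ?_, ?_⟩
    · simpa [h0, p0, q0] using tA
    · simpa [h0, p0, q0] using tB
  · refine ⟨!![0, 1 / r; 1, -p / r], !![p, 1; r, 0], ?_, ?_, ?_⟩
    · ext i j
      fin_cases i <;> fin_cases j <;> simp [Matrix.mul_apply, Matrix.vecMul, dotProduct, Fin.sum_univ_two, h0]
    · simp [Matrix.mul_apply, Matrix.vecMul, dotProduct, Fin.sum_univ_two]
      field_simp
      linear_combination r * tA - A 1 0 * hd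
    · simp [Matrix.mul_apply, Matrix.vecMul, dotProduct, Fin.sum_univ_two]
      field_simp
      linear_combination r * tB - B 1 0 * hd

theorem stmt_10 (A₁ A₂ : Matrix (Fin 2) (Fin 2) ℝ)
    (h₁ : Hurwitz A₁) (h₂ : Hurwitz A₂)
    (hrank : (A₁ * A₂ - A₂ * A₁).rank = 1) :
    ∃ B₁ B₂ : Matrix (Fin 2) (Fin 2) ℝ,
      ((B₁, B₂) = (A₁, A₂) ∨ (B₁, B₂) = (A₂, A₁)) ∧
      ∃ T : Matrix (Fin 2) (Fin 2) ℝ, IsUnit T ∧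
        (T⁻¹ * B₁ * T).IsDiag ∧ Matrix.BlockTriangular (T⁻¹ * B₂ * T) id := by
  have hC : A₁ * A₂ - A₂ * A₁ ≠ 0 := by
    intro h
    rw [h, Matrix.rank_zero] at hrank
    exact absurd hrank (by norm_num)
  have hdet : (A₁ * A₂ - A₂ * A₁).det = 0 := by
    by_contra h
    have := Matrix.rank_of_isUnit _ ((Matrix.isUnit_iff_isUnit_det _).2 (isUnit_iff_ne_zero.2 h))
    rw [hrank] at this
    simp at this
  obtain ⟨S, T, hST, hA, hB⟩ := aux_tri A₁ A₂ hC hdet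
  by_cases ha : (S * A₁ * T) 0 0 = (S * A₁ * T) 1 1
  · by_cases hb : (S * A₂ * T) 0 0 = (S * A₂ * T) 1 1
    · exfalso
      apply hC
      have hTS : T * S = 1 := mul_eq_one_comm.1 hST
      have hcomm : (S * A₁ * T) * (S * A₂ * T) = (S * A₂ * T) * (S * A₁ * T) := by
        generalize S * A₁ * T = U at *
        generalize S * A₂ * T = V at *
        ext i j
        fin_cases i <;> fin_cases j <;>
          simp [Matrix.mul_apply, Matrix.vecMul, dotProduct, Fin.sum_univ_two, hA, hB, ha, hb] <;> ring
      have key : ∀ X Y : Matrix (Fin 2) (Fin 2) ℝ,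
          T * ((S * X * T) * (S * Y * T)) * S = X * Y := by
        intro X Y
        calc _ = (T * S) * X * (T * S) * Y * (T * S) := by simp only [Matrix.mul_assoc]
          _ = X * Y := by simp [hTS]
      rw [← key A₁ A₂, ← key A₂ A₁, hcomm, sub_self]
    · exact ⟨A₂, A₁, Or.inr rfl, aux_diag A₂ A₁ S T hST hB hA hb⟩
  · exact ⟨A₁, A₂, Or.inl rfl, aux_diag A₁ A₂ S T hST hA hB ha⟩
end

section
/- Let A₁ and A₂ be Hurwitz real 2×2 matrices. Then det(σA₁ + (1−σ)A₂⁻¹) > 0 for every σ ∈ [0,1] if and only if tr(A₁A₂) > −2√(det(A₁)det(A₂)). -/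
open Matrix

lemma key_identity (A B : Matrix (Fin 2) (Fin 2) ℝ) (hB : 0 < B.det) (σ : ℝ) :
    (σ • A + (1 - σ) • B⁻¹).det * B.det =
      σ ^ 2 * (A.det * B.det) + σ * (1 - σ) * (A * B).trace + (1 - σ) ^ 2 := by
  have hu : IsUnit B.det := hB.ne'.isUnit
  rw [← Matrix.det_mul, Matrix.add_mul, Matrix.smul_mul, Matrix.smul_mul,
    Matrix.nonsing_inv_mul B hu, ← Matrix.det_mul]
  generalize A * B = M
  simp [Matrix.det_fin_two, Matrix.trace_fin_two]
  ring

theorem stmt_15 (A₁ A₂ : Matrix (Fin 2) (Fin 2) ℝ)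
    (h₁ : Hurwitz A₁) (h₂ : Hurwitz A₂) :
    (∀ σ ∈ Set.Icc (0:ℝ) 1, 0 < (σ • A₁ + (1 - σ) • A₂⁻¹).det) ↔
      (A₁ * A₂).trace > -2 * Real.sqrt (A₁.det * A₂.det) := by
  have hd : 0 < A₁.det * A₂.det := mul_pos h₁.2 h₂.2
  have hs : 0 < Real.sqrt (A₁.det * A₂.det) := Real.sqrt_pos.mpr hd
  have hsq : Real.sqrt (A₁.det * A₂.det) ^ 2 = A₁.det * A₂.det := Real.sq_sqrt hd.le
  have key := key_identity A₁ A₂ h₂.2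
  rw [← hsq] at key
  generalize Real.sqrt (A₁.det * A₂.det) = s at hs key ⊢
  generalize (A₁ * A₂).trace = t at key ⊢
  have key' : ∀ σ : ℝ, (σ • A₁ + (1 - σ) • A₂⁻¹).det * A₂.det =
      (σ * s - (1 - σ)) ^ 2 + σ * (1 - σ) * (t + 2 * s) := by
    intro σ
    rw [key]
    ring
  constructor
  · intro h
    have h1 : 0 < 1 / (1 + s) := by positivity
    have h2 : 1 - 1 / (1 + s) = s / (1 + s) := by
      field_simp
      ring
    have h3 : 0 < 1 - 1 / (1 + s) := by
      rw [h2]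
      positivity
    have h4 := mul_pos (h (1 / (1 + s)) ⟨h1.le, by linarith⟩) h₂.2
    have h5 : 1 / (1 + s) * s - (1 - 1 / (1 + s)) = 0 := by
      rw [h2]
      ring
    rw [key', h5] at h4
    have h6 : 0 < (1 / (1 + s) * (1 - 1 / (1 + s))) * (t + 2 * s) := by linarith
    have h7 := (mul_pos_iff_of_pos_left (mul_pos h1 h3)).mp h6
    linarith
  · intro h σ hσ
    have ht : 0 < t + 2 * s := by linarith
    refine (mul_pos_iff_of_pos_right h₂.2).mp ?_
    rw [key']
    rcases hσ.1.eq_or_lt with h0 | h0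
    · subst h0
      norm_num
    rcases hσ.2.eq_or_lt with h1 | h1
    · subst h1
      norm_num
      positivity
    · have : 0 < σ * (1 - σ) * (t + 2 * s) :=
        mul_pos (mul_pos h0 (by linarith)) ht
      nlinarith [sq_nonneg (σ * s - (1 - σ))]
end

section
/- Let A₁ and A₂ be Hurwitz real 2×2 matrices with Γ(A₁,A₂) ≤ −√(det(A₁)det(A₂)). Set σ₀ := (det(A₂) − Γ(A₁,A₂)) / (det(A₁) + det(A₂) − 2Γ(A₁,A₂)) and Δ := 4(Γ(A₁,A₂)² − det(A₁)det(A₂)). Then σ₀ ∈ (0,1) and det(σ₀A₁ + (1−σ₀)A₂) = −Δ / (4(det(A₁) + det(A₂) − 2Γ(A₁,A₂))) ≤ 0; moreover σ₀ is the minimum point of the function σ ↦ det(σA₁ + (1−σ)A₂) on ℝ. -/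
open Matrix

theorem stmt_16 (A₁ A₂ : Matrix (Fin 2) (Fin 2) ℝ)
    (h₁ : Hurwitz A₁) (h₂ : Hurwitz A₂)
    (hΓ : Gam A₁ A₂ ≤ - Real.sqrt (A₁.det * A₂.det))
    (σ₀ : ℝ) (hσ₀ : σ₀ = (A₂.det - Gam A₁ A₂) / (A₁.det + A₂.det - 2 * Gam A₁ A₂))
    (Δ : ℝ) (hΔ : Δ = 4 * ((Gam A₁ A₂) ^ 2 - A₁.det * A₂.det)) :
    σ₀ ∈ Set.Ioo (0:ℝ) 1 ∧
    (σ₀ • A₁ + (1 - σ₀) • A₂).det = -Δ / (4 * (A₁.det + A₂.det - 2 * Gam A₁ A₂)) ∧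
    (σ₀ • A₁ + (1 - σ₀) • A₂).det ≤ 0 ∧
    ∀ σ : ℝ, (σ₀ • A₁ + (1 - σ₀) • A₂).det ≤ (σ • A₁ + (1 - σ) • A₂).det := by
  have key : ∀ s : ℝ, (s • A₁ + (1 - s) • A₂).det =
      s ^ 2 * A₁.det + (1 - s) ^ 2 * A₂.det + 2 * s * (1 - s) * Gam A₁ A₂ := by
    intro s
    simp only [Gam, Matrix.det_fin_two, Matrix.trace_fin_two, Matrix.mul_apply,
      Fin.sum_univ_two, Matrix.add_apply, Matrix.smul_apply, smul_eq_mul]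
    ring
  simp only [key]
  have d1 := h₁.2
  have d2 := h₂.2
  generalize A₁.det = a at *
  generalize A₂.det = b at *
  generalize Gam A₁ A₂ = g at *
  have hab : 0 < a * b := mul_pos d1 d2
  have hs := Real.sqrt_pos.mpr hab
  have hsq := Real.sq_sqrt hab.le
  have hg : g < 0 := by linarith
  have hg2 : a * b ≤ g ^ 2 := by nlinarith
  have hD : 0 < a + b - 2 * g := by linarith
  have hmul : σ₀ * (a + b - 2 * g) = b - g := by
    rw [hσ₀]; exact div_mul_cancel₀ _ hD.ne'
  have hval : σ₀ ^ 2 * a + (1 - σ₀) ^ 2 * b + 2 * σ₀ * (1 - σ₀) * g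
      = -Δ / (4 * (a + b - 2 * g)) := by
    rw [eq_div_iff (by positivity), hΔ]
    linear_combination (4 * (σ₀ * (a + b - 2 * g) - (b - g))) * hmul
  refine ⟨⟨?_, ?_⟩, hval, ?_, ?_⟩
  · rw [hσ₀]; exact div_pos (by linarith) hD
  · rw [hσ₀, div_lt_one hD]; linarith
  · rw [hval]
    exact div_nonpos_of_nonpos_of_nonneg (by linarith) (by linarith)
  · intro σ
    have h0 : 0 ≤ (a + b - 2 * g) * (σ - σ₀) ^ 2 := by positivity
    have : σ ^ 2 * a + (1 - σ) ^ 2 * b + 2 * σ * (1 - σ) * g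
        - (σ₀ ^ 2 * a + (1 - σ₀) ^ 2 * b + 2 * σ₀ * (1 - σ₀) * g)
        = (a + b - 2 * g) * (σ - σ₀) ^ 2 := by
      linear_combination (2 * (σ - σ₀)) * hmul
    linarith
end

section
/- Let A₁ and A₂ be real 2×2 matrices and define the quadratic form Q on ℝ² by Q(x) := det(M(x)), where M(x) is the 2×2 matrix whose first column is A₁x and whose second column is A₂x. Writing Q(x₁,x₂) = a x₁² + b x₁x₂ + c x₂², the discriminant of Q satisfies b² − 4ac = 4(Γ(A₁,A₂)² − det(A₁)det(A₂)). -/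
open Matrix

/-- The quadratic form Q(x) := det(A₁x | A₂x), the determinant of the 2×2 matrix whose
first column is A₁x and whose second column is A₂x. -/
noncomputable def Q (A₁ A₂ : Matrix (Fin 2) (Fin 2) ℝ) (x : Fin 2 → ℝ) : ℝ :=
  (Matrix.of fun i => ![A₁.mulVec x i, A₂.mulVec x i]).det

theorem stmt_18 (A₁ A₂ : Matrix (Fin 2) (Fin 2) ℝ) (a b c : ℝ)
    (hQ : ∀ x : Fin 2 → ℝ, Q A₁ A₂ x = a * (x 0) ^ 2 + b * (x 0) * (x 1) + c * (x 1) ^ 2) :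
    b ^ 2 - 4 * a * c = 4 * ((Gam A₁ A₂) ^ 2 - A₁.det * A₂.det) := by
  have h1 := hQ ![1, 0]
  have h2 := hQ ![0, 1]
  have h3 := hQ ![1, 1]
  simp [Q, Matrix.det_fin_two, Matrix.mulVec, dotProduct, Fin.sum_univ_two] at h1 h2 h3
  have hb : b = A₁ 0 0 * A₂ 1 1 + A₁ 0 1 * A₂ 1 0 - A₂ 0 0 * A₁ 1 1 - A₂ 0 1 * A₁ 1 0 := by
    linear_combination h1 + h2 - h3
  rw [hb, ← h1, ← h2]
  simp only [Gam, Matrix.trace_fin_two, Matrix.det_fin_two, Matrix.mul_apply, Fin.sum_univ_two]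
  ring
end
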